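/- arXiv:2206.00353 — 2 statements merged into one kernel-verified Lean document; each statement's English description precedes it below -/
import Mathlib

section
/- Let $(X,\mathcal{B},\mu,f,T_f)$ be a dissipative composition dynamical system of bounded distortion generated by $W$, with $T_f$ invertible. If one of the following holds: (HC) $\limsup_{n\to\infty}\sup_{k\in\mathbb{Z}}\left(\frac{\mu(f^k(W))}{\mu(f^{k+n}(W))}\right)^{1/n}<1$; (HD) $\liminf_{n\to\infty}\inf_{k\in\mathbb{Z}}\left(\frac{\mu(f^k(W))}{\mu(f^{k+n}(W))}\right)^{1/n}>1$; (GH) $\limsup_{n\to\infty}\sup_{k\le 0}\left(\frac{\mu(f^{k-n}(W))}{\mu(f^k(W))}\right)^{1/n}<1$ and $\liminf_{n\to\infty}\inf_{k\ge 0}\left(\frac{\mu(f^k(W))}{\mu(f^{k+n}(W))}\right)^{1/n}>1$, then $T_f$ is strongly structurally stable. -/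
open MeasureTheory Filter Set ENNReal

/-- An invertible operator `T` is strongly structurally stable if for every
`γ > 0` there is `ε > 0` such that every Lipschitz perturbation `φ` with
`‖φ‖_∞ ≤ ε` and `Lip(φ) ≤ ε` yields `T + φ` conjugate to `T` via a
homeomorphism close to the identity. -/
def StronglyStructurallyStable {E : Type*} [NormedAddCommGroup E]
    [NormedSpace ℂ E] (T : E ≃L[ℂ] E) : Prop :=
  ∀ γ : ℝ, 0 < γ → ∃ ε : ℝ, 0 < ε ∧ ∀ φ : E → E, Continuous φ →
    (∀ x, ‖φ x‖ ≤ ε) → LipschitzWith (Real.toNNReal ε) φ →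
    ∃ h : E ≃ₜ E, (∀ x, h (T x) = T (h x) + φ (h x)) ∧ ∀ x, ‖h x - x‖ ≤ γ

lemma homeomorph_zpow_semiconj {E : Type*} [TopologicalSpace E] {S S' : E ≃ₜ E}
    {h : E → E} (hh : ∀ x, h (S x) = S' (h x))
    (n : ℤ) (x : E) : h ((S ^ n) x) = (S' ^ n) (h x) := by
  have hinv : ∀ x, h (S⁻¹ x) = S'⁻¹ (h x) := fun x => by
    apply S'.injective
    rw [← hh, ← Homeomorph.mul_apply, ← Homeomorph.mul_apply]
    simp
  induction n generalizing x with
  | zero => simp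
  | succ n ih => rw [zpow_add_one, zpow_add_one, Homeomorph.mul_apply, ih, hh]; rfl
  | pred n ih => rw [zpow_sub_one, zpow_sub_one, Homeomorph.mul_apply, ih, hinv]; rfl

section GreenOperator

variable {E : Type*} [NormedAddCommGroup E] [NormedSpace ℂ E]

/-- The series `∑ₙ Gₙ (g (S⁻ⁿ⁻¹ x))`, which solves `v ∘ S - T ∘ v = g` when `G` is a Green
sequence for `T`. -/
noncomputable def greenSum (G : ℤ → E →L[ℂ] E) (S : E ≃ₜ E) (g : E → E) (x : E) : E :=
  ∑' n : ℤ, G n (g ((S ^ (-(n + 1))) x))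

variable {G : ℤ → E →L[ℂ] E}

lemma norm_green_term_le {g : E → E} {b : ℝ} (hg : ∀ x, ‖g x‖ ≤ b) (n : ℤ) (y : E) :
    ‖G n (g y)‖ ≤ ‖G n‖ * b :=
  ((G n).le_opNorm _).trans (mul_le_mul_of_nonneg_left (hg y) (norm_nonneg _))

lemma summable_greenSum [CompleteSpace E] (hG : Summable fun n => ‖G n‖)
    {g : E → E} {b : ℝ} (hg : ∀ x, ‖g x‖ ≤ b) (y : ℤ → E) :
    Summable fun n => G n (g (y n)) :=
  Summable.of_norm_bounded (hG.mul_right b) fun n => norm_green_term_le hg n _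

lemma norm_greenSum_le (hG : Summable fun n => ‖G n‖) (S : E ≃ₜ E)
    {g : E → E} {b : ℝ} (hg : ∀ x, ‖g x‖ ≤ b) (x : E) :
    ‖greenSum G S g x‖ ≤ (∑' n, ‖G n‖) * b := by
  rw [← tsum_mul_right]
  exact tsum_of_norm_bounded (hG.mul_right b).hasSum fun n => norm_green_term_le hg n _

lemma continuous_greenSum [CompleteSpace E] (hG : Summable fun n => ‖G n‖) (S : E ≃ₜ E)
    {g : E → E} (hc : Continuous g) {b : ℝ} (hg : ∀ x, ‖g x‖ ≤ b) :
    Continuous (greenSum G S g) :=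
  continuous_tsum (fun n => (G n).continuous.comp (hc.comp (S ^ (-(n + 1))).continuous))
    (hG.mul_right b) fun n _ => norm_green_term_le hg n _

lemma greenSum_sub [CompleteSpace E] (hG : Summable fun n => ‖G n‖) (S : E ≃ₜ E)
    {g g' : E → E} {b : ℝ} (hg : ∀ x, ‖g x‖ ≤ b) (hg' : ∀ x, ‖g' x‖ ≤ b) (x : E) :
    greenSum G S g x - greenSum G S g' x = greenSum G S (fun y => g y - g' y) x := by
  unfold greenSum
  rw [← (summable_greenSum hG hg _).tsum_sub (summable_greenSum hG hg' _)]
  simp only [map_sub]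

lemma greenSum_apply_homeomorph [CompleteSpace E] {T : E ≃L[ℂ] E} (hG : Summable fun n => ‖G n‖)
    (hGT : ∀ n, G n = (T : E →L[ℂ] E) ∘L G (n - 1) + if n = 0 then 1 else 0) (S : E ≃ₜ E)
    {g : E → E} {b : ℝ} (hg : ∀ x, ‖g x‖ ≤ b) (x : E) :
    greenSum G S g (S x) = T (greenSum G S g x) + g x := by
  have hpow : ∀ n : ℤ, (S ^ (-(n + 1))) (S x) = (S ^ (-n)) x := fun n => by
    rw [← Homeomorph.mul_apply, ← zpow_add_one]; congr 2; ring
  have hterm : ∀ n : ℤ, G n (g ((S ^ (-n)) x)) =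
      T (G (n - 1) (g ((S ^ (-n)) x))) + if n = 0 then g x else 0 := fun n => by
    conv_lhs => rw [hGT n]
    by_cases h : n = 0
    · subst h; simp
    · simp [h]
  have hs : Summable fun n : ℤ => T (G (n - 1) (g ((S ^ (-n)) x))) := by
    have := (summable_greenSum hG hg fun n : ℤ => (S ^ (-(n + 1))) x).map T T.continuous
    rw [← (Equiv.subRight (1 : ℤ)).summable_iff] at this
    refine this.congr fun n => ?_
    simp only [Function.comp_apply, Equiv.subRight_apply, sub_add_cancel]
  have hshift : T (greenSum G S g x) = ∑' n : ℤ, T (G (n - 1) (g ((S ^ (-n)) x))) := by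
    unfold greenSum
    rw [T.map_tsum, ← (Equiv.subRight (1 : ℤ)).tsum_eq]
    simp
  rw [hshift]
  unfold greenSum
  simp only [hpow, hterm]
  rw [hs.tsum_add (summable_of_hasFiniteSupport ((Set.finite_singleton (0 : ℤ)).subset
    (by intro n; simp +contextual)))]
  simp

lemma greenSum_semiconj {S S' : E ≃ₜ E} {h : E → E} (hh : ∀ x, h (S x) = S' (h x))
    (g : E → E) (x : E) : greenSum G S' g (h x) = greenSum G S (g ∘ h) x := by
  simp only [greenSum, Function.comp_apply, homeomorph_zpow_semiconj hh]

/-- The fixed point equation `v = greenSum G S (φ ∘ (id + v))` has a bounded continuous solution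
for a bounded perturbation `φ` with small Lipschitz constant. -/
lemma exists_greenSum_fixedPoint [CompleteSpace E] (hG : Summable fun n => ‖G n‖) (S : E ≃ₜ E)
    {φ : E → E} (hφ : Continuous φ) {b : ℝ} (hb : ∀ x, ‖φ x‖ ≤ b) {l : ℝ} (hl0 : 0 ≤ l)
    (hl : ∀ x y, ‖φ x - φ y‖ ≤ l * ‖x - y‖) (hsmall : (∑' n, ‖G n‖) * l < 1) :
    ∃ v : E → E, Continuous v ∧ ∀ x, v x = greenSum G S (fun y => φ (y + v y)) x := by
  let F : BoundedContinuousFunction E E → BoundedContinuousFunction E E := fun v =>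
    BoundedContinuousFunction.ofNormedAddCommGroup (greenSum G S (fun y => φ (y + v y)))
      (continuous_greenSum hG S (hφ.comp (continuous_id.add v.continuous)) fun y => hb _)
      ((∑' n, ‖G n‖) * b) (norm_greenSum_le hG S fun y => hb _)
  have hC : 0 ≤ ∑' n, ‖G n‖ := tsum_nonneg fun n => norm_nonneg _
  have hF : ContractingWith (Real.toNNReal ((∑' n, ‖G n‖) * l)) F := by
    refine ⟨by simpa using hsmall, LipschitzWith.of_dist_le_mul fun v w => ?_⟩
    rw [Real.coe_toNNReal _ (mul_nonneg hC hl0)]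
    refine (BoundedContinuousFunction.dist_le (by positivity)).2 fun x => ?_
    rw [dist_eq_norm]
    change ‖greenSum G S (fun y => φ (y + v y)) x - greenSum G S (fun y => φ (y + w y)) x‖ ≤ _
    rw [greenSum_sub hG S (b := b) (fun y => hb _) (fun y => hb _), mul_assoc]
    refine norm_greenSum_le hG S (fun y => (hl _ _).trans ?_) x
    refine mul_le_mul_of_nonneg_left ?_ hl0
    rw [add_sub_add_left_eq_sub, ← dist_eq_norm]
    exact BoundedContinuousFunction.dist_coe_le_dist y
  obtain ⟨v, hv⟩ : ∃ v, F v = v := ⟨_, hF.fixedPoint_isFixedPt⟩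
  exact ⟨v, v.continuous, fun x => (DFunLike.congr_fun hv x).symm⟩

/-- An operator with an absolutely summable Green sequence is strongly structurally stable. -/
theorem stronglyStructurallyStable_of_green [CompleteSpace E] {T : E ≃L[ℂ] E}
    (hG : Summable fun n => ‖G n‖)
    (hGT : ∀ n, G n = (T : E →L[ℂ] E) ∘L G (n - 1) + if n = 0 then 1 else 0) :
    StronglyStructurallyStable T := by
  intro γ hγ
  set C : ℝ := ∑' n, ‖G n‖ with hC
  have hC0 : 0 ≤ C := tsum_nonneg fun n => norm_nonneg _
  set N : ℝ := ‖(T.symm : E →L[ℂ] E)‖ with hN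
  have hN0 : 0 ≤ N := norm_nonneg _
  obtain ⟨ε, hε, hε1, hε2, hε3⟩ : ∃ ε : ℝ, 0 < ε ∧ C * ε ≤ γ ∧ C * ε < 1 ∧ N * ε < 1 := by
    refine ⟨min γ 1 / (C + N + 1), by positivity, ?_, ?_, ?_⟩
    · rw [← mul_div_assoc, div_le_iff₀ (by positivity)]
      nlinarith [min_le_left γ 1]
    · rw [← mul_div_assoc, div_lt_one (by positivity)]
      nlinarith [min_le_right γ 1]
    · rw [← mul_div_assoc, div_lt_one (by positivity)]
      nlinarith [min_le_right γ 1]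
  refine ⟨ε, hε, fun φ hφ hb hLip => ?_⟩
  have hl : ∀ x y, ‖φ x - φ y‖ ≤ ε * ‖x - y‖ := fun x y => by
    simpa [dist_eq_norm, Real.coe_toNNReal _ hε.le] using hLip.dist_le_mul x y
  have happrox : ApproximatesLinearOn (fun x => T x + φ x) (T : E →L[ℂ] E) univ
      (Real.toNNReal ε) := fun x _ y _ => by
    rw [Real.coe_toNNReal _ hε.le]
    refine le_trans (le_of_eq ?_) (hl x y)
    simp only [ContinuousLinearEquiv.coe_coe, map_sub]
    congr 1; abel
  have hlt : Subsingleton E ∨ Real.toNNReal ε < ‖(T.symm : E →L[ℂ] E)‖₊⁻¹ := by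
    rcases T.subsingleton_or_nnnorm_symm_pos with h | h
    · exact Or.inl h
    · right
      rw [← NNReal.coe_lt_coe, Real.coe_toNNReal _ hε.le, NNReal.coe_inv, coe_nnnorm,
        lt_inv_comm₀ hε (by simpa using h), lt_inv_comm₀ (by simpa using h) hε]
      rw [← one_div, lt_div_iff₀ (by simpa using h), mul_comm]
      exact hε3
  let S : E ≃ₜ E := happrox.toHomeomorph _ hlt
  have hS : ∀ x, S x = T x + φ x := fun x => rfl
  let T' : E ≃ₜ E := T.toHomeomorph
  have hT' : ∀ x, T' x = T x := fun x => rfl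
  obtain ⟨v, hvc, hv⟩ := exists_greenSum_fixedPoint hG T' hφ hb hε.le hl hε2
  let w : E → E := fun x => - greenSum G S φ x
  have hwc : Continuous w := (continuous_greenSum hG S hφ hb).neg
  let h : E → E := fun x => x + v x
  let k : E → E := fun x => x + w x
  have hh : ∀ x, h (T' x) = S (h x) := fun x => by
    change T' x + v (T' x) = S (x + v x)
    rw [hv, greenSum_apply_homeomorph hG hGT T' (b := ε) (fun y => hb _), ← hv, hS, map_add, hT']
    abel
  have hk : ∀ x, k (S x) = T' (k x) := fun x => by
    change S x + - greenSum G S φ (S x) = T (x + - greenSum G S φ x)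
    rw [greenSum_apply_homeomorph hG hGT S hb, hS, map_add, map_neg]
    abel
  have hkh : ∀ x, k (h x) = x := fun x => by
    change (x + v x) + - greenSum G S φ (h x) = x
    rw [greenSum_semiconj hh, hv]
    change x + greenSum G T' (φ ∘ h) x + _ = _
    abel
  have hvk : ∀ x, v (k x) = greenSum G S (fun y => φ (h (k y))) x := fun x => by
    rw [hv, greenSum_semiconj hk]
    rfl
  have hy : ∀ x, h (k x) - x = greenSum G S (fun y => φ (h (k y)) - φ y) x := fun x => by
    rw [← greenSum_sub hG S (b := ε) (fun y => hb _) hb, ← hvk]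
    change x + - greenSum G S φ x + v (k x) - x = _
    abel
  have hiter : ∀ (m : ℕ) x, ‖h (k x) - x‖ ≤ (C * ε) ^ m * (C * (2 * ε)) := by
    intro m
    induction m with
    | zero =>
      intro x
      rw [hy, pow_zero, one_mul]
      exact norm_greenSum_le hG S (fun y => (norm_sub_le _ _).trans
        (by linarith [hb (h (k y)), hb y])) x
    | succ m ih =>
      intro x
      rw [hy, pow_succ', mul_assoc, mul_assoc]
      exact norm_greenSum_le hG S (fun y => (hl _ _).trans
        (mul_le_mul_of_nonneg_left (ih y) hε.le)) x
  have hhk : ∀ x, h (k x) = x := fun x => by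
    have hlim := (tendsto_pow_atTop_nhds_zero_of_lt_one (by positivity) hε2).mul_const
      (C * (2 * ε))
    rw [zero_mul] at hlim
    exact sub_eq_zero.1 (norm_le_zero_iff.1 (ge_of_tendsto' hlim fun m => hiter m x))
  refine ⟨⟨⟨h, k, hkh, hhk⟩, continuous_id.add hvc, continuous_id.add hwc⟩,
    fun x => hh x, fun x => ?_⟩
  change ‖x + v x - x‖ ≤ γ
  rw [add_sub_cancel_left, hv]
  exact (norm_greenSum_le hG T' (fun y => hb _) x).trans hε1

end GreenOperator

section Indicator

variable {X : Type*} [MeasurableSpace X] {μ : Measure X} {p : ℝ≥0∞} [Fact (1 ≤ p)]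

/-- Multiplication by the indicator function of a measurable set, as an operator on `Lp`. -/
noncomputable def indicatorLpCLM (μ : Measure X) (p : ℝ≥0∞) [Fact (1 ≤ p)] {A : Set X}
    (hA : MeasurableSet A) : Lp ℂ p μ →L[ℂ] Lp ℂ p μ :=
  LinearMap.mkContinuous
    { toFun := fun f => ((Lp.memLp f).indicator hA).toLp _
      map_add' := fun f g => by
        rw [← MemLp.toLp_add]
        refine MemLp.toLp_congr _ _ ?_
        filter_upwards [Lp.coeFn_add f g] with x hx
        by_cases h : x ∈ A <;> simp only [h, indicator_of_mem, indicator_of_notMem, Pi.add_apply,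
          not_false_eq_true, hx, add_zero]
      map_smul' := fun z f => by
        rw [RingHom.id_apply, ← MemLp.toLp_const_smul]
        refine MemLp.toLp_congr _ _ ?_
        filter_upwards [Lp.coeFn_smul z f] with x hx
        by_cases h : x ∈ A <;> simp only [h, indicator_of_mem,
          indicator_of_notMem, Pi.smul_apply, not_false_eq_true, hx, smul_zero] } 1
    fun f => by
      rw [one_mul]
      refine Lp.norm_le_norm_of_ae_le ?_
      filter_upwards [((Lp.memLp f).indicator hA).coeFn_toLp] with x hx
      change ‖((Lp.memLp f).indicator hA).toLp _ x‖ ≤ _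
      rw [hx]
      exact norm_indicator_le_norm_self _ _

lemma coeFn_indicatorLpCLM {A : Set X} (hA : MeasurableSet A) (f : Lp ℂ p μ) :
    (indicatorLpCLM μ p hA f : X → ℂ) =ᵐ[μ] A.indicator f :=
  ((Lp.memLp f).indicator hA).coeFn_toLp

lemma indicatorLpCLM_add_compl {A : Set X} (hA : MeasurableSet A) :
    indicatorLpCLM μ p hA + indicatorLpCLM μ p hA.compl = 1 := by
  ext1 f
  refine Lp.ext ?_
  rw [add_apply, one_apply_eq_self]
  filter_upwards [Lp.coeFn_add (indicatorLpCLM μ p hA f) (indicatorLpCLM μ p hA.compl f),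
    coeFn_indicatorLpCLM hA f, coeFn_indicatorLpCLM hA.compl f] with x h1 h2 h3
  rw [h1, Pi.add_apply, h2, h3, indicator_self_add_compl_apply]

/-- A composition operator restricted to functions supported in `A` is bounded in terms of the
distortion of the measure on subsets of `A`. -/
lemma norm_comp_indicatorLpCLM_le (hpT : p ≠ ⊤) {A : Set X} (hA : MeasurableSet A)
    {u : X → X} (hu : Measure.QuasiMeasurePreserving u μ μ)
    {U : Lp ℂ p μ →L[ℂ] Lp ℂ p μ} (hU : ∀ φ, (U φ : X → ℂ) =ᵐ[μ] fun x => φ (u x))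
    {D : ℝ≥0∞} (hDT : D ≠ ⊤)
    (hD : ∀ B, MeasurableSet B → B ⊆ A → μ (u ⁻¹' B) ≤ D * μ B) :
    ‖U ∘L indicatorLpCLM μ p hA‖ ≤ (D ^ (1 / p.toReal)).toReal := by
  refine ContinuousLinearMap.opNorm_le_bound _ ENNReal.toReal_nonneg fun f => ?_
  have hfin : D ^ (1 / p.toReal) ≠ ⊤ := ENNReal.rpow_ne_top_of_nonneg (by positivity) hDT
  rw [Lp.norm_def, Lp.norm_def, ← ENNReal.toReal_mul]
  refine ENNReal.toReal_mono (ENNReal.mul_ne_top hfin (Lp.eLpNorm_ne_top f)) ?_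
  have hae : (U (indicatorLpCLM μ p hA f) : X → ℂ) =ᵐ[μ] (A.indicator f) ∘ u :=
    (hU _).trans (hu.ae_eq_comp (coeFn_indicatorLpCLM hA f))
  have hmeas : AEStronglyMeasurable (A.indicator f) (Measure.map u μ) :=
    ((Lp.aestronglyMeasurable f).indicator hA).mono_ac hu.absolutelyContinuous
  have hle : (Measure.map u μ).restrict A ≤ D • μ := by
    refine Measure.le_iff.2 fun B hB => ?_
    rw [Measure.restrict_apply hB, Measure.map_apply hu.measurable (hB.inter hA),
      Measure.smul_apply, smul_eq_mul]
    exact (hD _ (hB.inter hA) inter_subset_right).trans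
      (mul_le_mul_right (measure_mono inter_subset_left) _)
  calc eLpNorm (U (indicatorLpCLM μ p hA f)) p μ
      = eLpNorm (A.indicator f) p (Measure.map u μ) := by
        rw [eLpNorm_congr_ae hae, eLpNorm_map_measure hmeas hu.aemeasurable]
    _ = eLpNorm f p ((Measure.map u μ).restrict A) := eLpNorm_indicator_eq_eLpNorm_restrict hA
    _ ≤ eLpNorm f p (D • μ) := eLpNorm_mono_measure _ hle
    _ = D ^ (1 / p.toReal) * eLpNorm f p μ := by
        rw [eLpNorm_smul_measure_of_ne_top hpT, smul_eq_mul]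
        simp

end Indicator

section Composition

variable {X : Type*} [MeasurableSpace X] {μ : Measure X}

lemma quasiMeasurePreserving_zpow {e : Equiv.Perm X}
    (he : Measure.QuasiMeasurePreserving e μ μ)
    (he' : Measure.QuasiMeasurePreserving e.symm μ μ) (n : ℤ) :
    Measure.QuasiMeasurePreserving (e ^ n : Equiv.Perm X) μ μ := by
  induction n with
  | zero => simpa using Measure.QuasiMeasurePreserving.id μ
  | succ n ih => rw [zpow_add_one]; exact ih.comp he
  | pred n ih => rw [zpow_sub_one]; exact ih.comp he'

lemma coeFn_zpow_composition {p : ℝ≥0∞} [Fact (1 ≤ p)] {e : Equiv.Perm X}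
    (he : Measure.QuasiMeasurePreserving e μ μ)
    (he' : Measure.QuasiMeasurePreserving e.symm μ μ)
    {T : Lp ℂ p μ ≃L[ℂ] Lp ℂ p μ}
    (hT : ∀ φ : Lp ℂ p μ, (T φ : X → ℂ) =ᵐ[μ] fun x => φ (e x)) (n : ℤ) (φ : Lp ℂ p μ) :
    ((T ^ n) φ : X → ℂ) =ᵐ[μ] fun x => φ ((e ^ n) x) := by
  have hT' : ∀ φ : Lp ℂ p μ, (T⁻¹ φ : X → ℂ) =ᵐ[μ] fun x => φ (e⁻¹ x) := fun φ => by
    have h := he'.ae_eq_comp (hT (T⁻¹ φ))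
    rw [show T (T⁻¹ φ) = φ from T.apply_symm_apply φ] at h
    filter_upwards [h] with x hx
    simpa using hx.symm
  induction n generalizing φ with
  | zero => exact EventuallyEq.rfl
  | succ n ih =>
    rw [zpow_add_one, add_comm, zpow_add, zpow_one]
    exact (ih (T φ)).trans
      ((quasiMeasurePreserving_zpow he he' n).ae_eq_comp (hT φ))
  | pred n ih =>
    rw [zpow_sub_one, sub_eq_neg_add, zpow_add, zpow_neg_one]
    exact (ih (T⁻¹ φ)).trans
      ((quasiMeasurePreserving_zpow he he' (-n)).ae_eq_comp (hT' φ))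

lemma measure_zpow_image_ne_top {e : Equiv.Perm X} {c c' : ℝ≥0∞} (hcT : c ≠ ⊤) (hc'T : c' ≠ ⊤)
    (hm : ∀ (n : ℤ) (B : Set X), MeasurableSet B → MeasurableSet ((e ^ n : Equiv.Perm X) '' B))
    (hb : ∀ B : Set X, MeasurableSet B → μ (⇑e ⁻¹' B) ≤ c * μ B)
    (hb' : ∀ B : Set X, MeasurableSet B → μ (⇑e '' B) ≤ c' * μ B)
    {W : Set X} (hW : MeasurableSet W) (hWT : μ W ≠ ⊤) (n : ℤ) :
    μ ((e ^ n : Equiv.Perm X) '' W) ≠ ⊤ := by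
  induction n with
  | zero => simpa using hWT
  | succ n ih =>
    rw [add_comm, zpow_add, zpow_one, Equiv.Perm.coe_mul, image_comp]
    exact ne_top_of_le_ne_top (ENNReal.mul_ne_top hc'T ih) (hb' _ (hm _ _ hW))
  | pred n ih =>
    rw [sub_eq_neg_add, zpow_add, zpow_neg_one, Equiv.Perm.coe_mul, image_comp,
      Equiv.Perm.inv_def, Equiv.image_symm_eq_preimage]
    exact ne_top_of_le_ne_top (ENNReal.mul_ne_top hcT ih) (hb _ (hm _ _ hW))

/-- Bounded distortion controls the measure of a shifted set by the growth of the measures of the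
translates of the wandering set which it meets. -/
lemma measure_zpow_image_le {e : Equiv.Perm X}
    (hm : ∀ (n : ℤ) (B : Set X), MeasurableSet B → MeasurableSet ((e ^ n : Equiv.Perm X) '' B))
    {W : Set X} (hWm : MeasurableSet W) (hW0 : 0 < μ W) (hWfin : μ W ≠ ⊤)
    (hcover : (⋃ k : ℤ, ⇑(e ^ k) '' W) = Set.univ)
    (hdisj : Pairwise (fun k l : ℤ => Disjoint (⇑(e ^ k) '' W) (⇑(e ^ l) '' W)))
    {K : ℝ≥0∞} (hK0 : 0 < K) (hKT : K ≠ ⊤)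
    (hbd : ∀ (k : ℤ) (B : Set X), MeasurableSet B → B ⊆ W →
        K⁻¹ * (μ (⇑(e ^ k) '' W) * μ B) ≤ μ (⇑(e ^ k) '' B) * μ W ∧
        μ (⇑(e ^ k) '' B) * μ W ≤ K * (μ (⇑(e ^ k) '' W) * μ B))
    {m : ℤ} {ρ : ℝ≥0∞} {B : Set X} (hB : MeasurableSet B)
    (hρ : ∀ k : ℤ, (B ∩ ⇑(e ^ k) '' W).Nonempty →
      μ (⇑(e ^ (k + m)) '' W) ≤ ρ * μ (⇑(e ^ k) '' W)) :
    μ (⇑(e ^ m) '' B) ≤ K ^ 2 * ρ * μ B := by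
  have hpiece : ∀ k : ℤ, μ (⇑(e ^ m) '' (B ∩ ⇑(e ^ k) '' W)) ≤
      K ^ 2 * ρ * μ (B ∩ ⇑(e ^ k) '' W) := fun k => by
    rcases (B ∩ ⇑(e ^ k) '' W).eq_empty_or_nonempty with h | h
    · simp [h]
    set B₀ : Set X := ⇑(e ^ (-k)) '' (B ∩ ⇑(e ^ k) '' W) with hB₀
    have hB₀m : MeasurableSet B₀ := hm _ _ (hB.inter (hm _ _ hWm))
    have himg : ⇑(e ^ k) '' B₀ = B ∩ ⇑(e ^ k) '' W := by
      rw [hB₀, ← image_comp, ← Equiv.Perm.coe_mul, ← zpow_add]; simp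
    have hB₀W : B₀ ⊆ W := by
      have : B₀ ⊆ ⇑(e ^ (-k)) '' (⇑(e ^ k) '' W) := image_mono inter_subset_right
      rw [← image_comp, ← Equiv.Perm.coe_mul, ← zpow_add] at this
      simpa using this
    have himg' : ⇑(e ^ m) '' (B ∩ ⇑(e ^ k) '' W) = ⇑(e ^ (k + m)) '' B₀ := by
      rw [← himg, ← image_comp, ← Equiv.Perm.coe_mul, ← zpow_add, add_comm]
    have h1 := (hbd k B₀ hB₀m hB₀W).1
    have h2 := (hbd (k + m) B₀ hB₀m hB₀W).2
    rw [himg, ENNReal.inv_mul_le_iff hK0.ne' hKT] at h1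
    rw [himg', ← ENNReal.mul_le_mul_iff_left hW0.ne' hWfin]
    calc _ ≤ K * (μ (⇑(e ^ (k + m)) '' W) * μ B₀) := h2
      _ ≤ K * (ρ * μ (⇑(e ^ k) '' W) * μ B₀) := by gcongr; exact hρ k h
      _ = K * ρ * (μ (⇑(e ^ k) '' W) * μ B₀) := by ring
      _ ≤ K * ρ * (K * (μ (B ∩ ⇑(e ^ k) '' W) * μ W)) := by gcongr
      _ = _ := by ring
  have hsplit : B = ⋃ k : ℤ, B ∩ ⇑(e ^ k) '' W := by
    rw [← inter_iUnion, hcover, inter_univ]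
  calc μ (⇑(e ^ m) '' B) = μ (⋃ k : ℤ, ⇑(e ^ m) '' (B ∩ ⇑(e ^ k) '' W)) := by
        rw [← image_iUnion, ← hsplit]
    _ ≤ ∑' k : ℤ, μ (⇑(e ^ m) '' (B ∩ ⇑(e ^ k) '' W)) := measure_iUnion_le _
    _ ≤ ∑' k : ℤ, K ^ 2 * ρ * μ (B ∩ ⇑(e ^ k) '' W) := ENNReal.tsum_le_tsum hpiece
    _ = K ^ 2 * ρ * μ B := by
        rw [ENNReal.tsum_mul_left, ← measure_iUnion
          (fun k l hkl => (hdisj hkl).mono inter_subset_right inter_subset_right)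
          (fun k => hB.inter (hm _ _ hWm)), ← hsplit]

/-- If the forward iterates of `T` are summable in norm on the range of `P` and the backward ones
on the range of `Q`, with `P + Q = 1`, then `T` is strongly structurally stable. -/
theorem stronglyStructurallyStable_of_summable {E : Type*} [NormedAddCommGroup E]
    [NormedSpace ℂ E] [CompleteSpace E] {T : E ≃L[ℂ] E} {P Q : E →L[ℂ] E} (hPQ : P + Q = 1)
    (hP : Summable fun n : ℕ => ‖((T ^ (n : ℤ) : E ≃L[ℂ] E) : E →L[ℂ] E) ∘L P‖)
    (hQ : Summable fun n : ℕ => ‖((T ^ (-(n : ℤ)) : E ≃L[ℂ] E) : E →L[ℂ] E) ∘L Q‖) :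
    StronglyStructurallyStable T := by
  let G : ℤ → E →L[ℂ] E := fun n => if 0 ≤ n then ((T ^ n : E ≃L[ℂ] E) : E →L[ℂ] E) ∘L P
    else -(((T ^ n : E ≃L[ℂ] E) : E →L[ℂ] E) ∘L Q)
  refine stronglyStructurallyStable_of_green (G := G) (Summable.of_nat_of_neg_add_one ?_ ?_) ?_
  · simpa [G] using hP
  · refine ((summable_nat_add_iff 1).2 hQ).congr fun n => ?_
    have h : ¬ (0 : ℤ) ≤ -((n : ℤ) + 1) := by omega
    simp only [G, if_neg h, norm_neg]
    push_cast
    rfl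
  · intro n
    have hT : ∀ x, (T ^ n) x = T ((T ^ (n - 1)) x) := fun x => by
      conv_lhs => rw [← add_sub_cancel 1 n, zpow_add, zpow_one]
      rfl
    ext x
    rcases lt_trichotomy n 0 with h | rfl | h
    · have h1 : ¬ 0 ≤ n := by omega
      have h2 : ¬ 0 ≤ n - 1 := by omega
      have h3 : n ≠ 0 := by omega
      simp only [G, if_neg h1, if_neg h2, if_neg h3]
      simp [hT]
    · have hx : P x + Q x = x := DFunLike.congr_fun hPQ x
      simp only [G]
      have hT0 := hT (Q x)
      simp only [zpow_zero, zero_sub] at hT0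
      have hTQ : T ((T ^ (-1 : ℤ)) (Q x)) = Q x := hT0.symm
      simp [-zpow_neg, hTQ]
      rw [eq_neg_add_iff_add_eq, add_comm]
      exact hx
    · have h1 : 0 ≤ n := by omega
      have h2 : 0 ≤ n - 1 := by omega
      have h3 : n ≠ 0 := by omega
      simp only [G, if_pos h1, if_pos h2, if_neg h3]
      simp [hT]

lemma summable_of_eventually_le_rpow_geometric {q : ℝ} (hq : 0 < q) {D r : ℝ≥0∞} (hr : r < 1)
    {a : ℕ → ℝ} (ha0 : ∀ n, 0 ≤ a n)
    (ha : ∀ᶠ n in atTop, a n ≤ ((D * r ^ n) ^ q).toReal) : Summable a := by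
  have hq1 : (r ^ q).toReal < 1 := by
    rw [← ENNReal.toReal_one]
    exact ENNReal.toReal_strict_mono ENNReal.one_ne_top (ENNReal.rpow_lt_one hr hq)
  have hs := (summable_geometric_of_lt_one ENNReal.toReal_nonneg hq1).mul_left (D ^ q).toReal
  refine hs.of_norm_bounded_eventually_nat ?_
  filter_upwards [ha] with n hn
  rw [Real.norm_of_nonneg (ha0 n)]
  refine hn.trans (le_of_eq ?_)
  rw [ENNReal.mul_rpow_of_nonneg _ _ hq.le, ENNReal.toReal_mul, ← ENNReal.toReal_pow,
    ← ENNReal.rpow_natCast, ← ENNReal.rpow_natCast, ← ENNReal.rpow_mul, ← ENNReal.rpow_mul,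
    mul_comm q]

lemma le_pow_mul_of_div_rpow_le {a b r : ℝ≥0∞} (hb0 : b ≠ 0) (hbT : b ≠ ⊤) {n : ℕ} (hn : n ≠ 0)
    (h : (a / b) ^ (1 / (n : ℝ)) ≤ r) : a ≤ r ^ n * b := by
  rw [← ENNReal.div_le_iff hb0 hbT, ← ENNReal.rpow_natCast]
  rwa [one_div, ENNReal.rpow_inv_le_iff (by positivity)] at h

lemma le_inv_pow_mul_of_le_div_rpow {a b R : ℝ≥0∞} (hb0 : b ≠ 0) (hbT : b ≠ ⊤) (hR : R ≠ 0)
    (hRT : R ≠ ⊤) {n : ℕ} (hn : n ≠ 0) (h : R ≤ (a / b) ^ (1 / (n : ℝ))) :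
    b ≤ R⁻¹ ^ n * a := by
  rw [one_div, ENNReal.le_rpow_inv_iff (by positivity), ENNReal.rpow_natCast,
    ENNReal.le_div_iff_mul_le (Or.inl hb0) (Or.inl hbT)] at h
  rw [← ENNReal.inv_pow, mul_comm, ← div_eq_mul_inv,
    ENNReal.le_div_iff_mul_le (Or.inl (pow_ne_zero _ hR)) (Or.inl (ENNReal.pow_ne_top hRT)),
    mul_comm]
  exact h

/-- Abstract form of the growth conditions: the measures `μ (e ^ k '' W)` decay geometrically to
the left of the indices in `I` and to the right of the indices outside `I`. -/
theorem stronglyStructurallyStable_of_geometric_decay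
    {X : Type*} [MeasurableSpace X] {μ : Measure X} {p : ℝ≥0∞} [Fact (1 ≤ p)] (hpT : p ≠ ⊤)
    {e : Equiv.Perm X} (he : Measure.QuasiMeasurePreserving e μ μ)
    (he' : Measure.QuasiMeasurePreserving e.symm μ μ)
    {W : Set X} (hWm : MeasurableSet W) (hW0 : 0 < μ W) (hWfin : μ W ≠ ⊤)
    (hcover : (⋃ k : ℤ, ⇑(e ^ k) '' W) = Set.univ)
    (hdisj : Pairwise (fun k l : ℤ => Disjoint (⇑(e ^ k) '' W) (⇑(e ^ l) '' W)))
    {K : ℝ≥0∞} (hK0 : 0 < K) (hKT : K ≠ ⊤)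
    (hbd : ∀ (k : ℤ) (B : Set X), MeasurableSet B → B ⊆ W →
        K⁻¹ * (μ (⇑(e ^ k) '' W) * μ B) ≤ μ (⇑(e ^ k) '' B) * μ W ∧
        μ (⇑(e ^ k) '' B) * μ W ≤ K * (μ (⇑(e ^ k) '' W) * μ B))
    {T : Lp ℂ p μ ≃L[ℂ] Lp ℂ p μ}
    (hT : ∀ φ : Lp ℂ p μ, (T φ : X → ℂ) =ᵐ[μ] fun x => φ (e x))
    (I : Set ℤ) {r : ℝ≥0∞} (hr : r < 1)
    (hI : ∀ᶠ n : ℕ in atTop, ∀ k ∈ I,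
      μ (⇑(e ^ (k - (n : ℤ))) '' W) ≤ r ^ n * μ (⇑(e ^ k) '' W))
    (hI' : ∀ᶠ n : ℕ in atTop, ∀ k ∉ I,
      μ (⇑(e ^ (k + (n : ℤ))) '' W) ≤ r ^ n * μ (⇑(e ^ k) '' W)) :
    StronglyStructurallyStable T := by
  have hqmp := quasiMeasurePreserving_zpow he he'
  have hpre : ∀ (n : ℤ) (B : Set X), ⇑(e ^ n) ⁻¹' B = ⇑(e ^ (-n)) '' B := fun n B => by
    rw [zpow_neg, Equiv.Perm.inv_def, Equiv.image_symm_eq_preimage]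
  have hm : ∀ (n : ℤ) (B : Set X), MeasurableSet B → MeasurableSet (⇑(e ^ n) '' B) :=
    fun n B hB => by
      rw [← neg_neg n, ← hpre]
      exact (hqmp (-n)).measurable hB
  have hp : 0 < 1 / p.toReal := one_div_pos.2
    (ENNReal.toReal_pos (zero_lt_one.trans_le Fact.out).ne' hpT)
  have hD : ∀ n : ℕ, K ^ 2 * r ^ n ≠ ⊤ := fun n =>
    ENNReal.mul_ne_top (ENNReal.pow_ne_top hKT) (ENNReal.pow_ne_top (hr.trans_le le_top).ne)
  set A : Set X := ⋃ k ∈ I, ⇑(e ^ k) '' W with hAdef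
  have hA : MeasurableSet A :=
    MeasurableSet.biUnion (Set.to_countable I) fun k _ => hm k W hWm
  have hAI : ∀ k : ℤ, (A ∩ ⇑(e ^ k) '' W).Nonempty → k ∈ I := by
    rintro k ⟨x, hx, hxk⟩
    obtain ⟨l, hl, hxl⟩ := mem_iUnion₂.1 hx
    by_cases hkl : k = l
    · rwa [hkl]
    · exact absurd hxl (disjoint_left.1 (hdisj hkl) hxk)
  have hAI' : ∀ k : ℤ, (Aᶜ ∩ ⇑(e ^ k) '' W).Nonempty → k ∉ I := by
    rintro k ⟨x, hx, hxk⟩ hk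
    exact hx (mem_iUnion₂.2 ⟨k, hk, hxk⟩)
  refine stronglyStructurallyStable_of_summable (indicatorLpCLM_add_compl hA)
    (summable_of_eventually_le_rpow_geometric hp hr (D := K ^ 2) (fun n => norm_nonneg _) ?_)
    (summable_of_eventually_le_rpow_geometric hp hr (D := K ^ 2) (fun n => norm_nonneg _) ?_)
  · filter_upwards [hI] with n hn
    refine norm_comp_indicatorLpCLM_le hpT hA (hqmp n)
      (coeFn_zpow_composition he he' hT n) (hD n) fun B hB hBA => ?_
    rw [hpre]
    refine measure_zpow_image_le hm hWm hW0 hWfin hcover hdisj hK0 hKT hbd hB fun k hk => ?_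
    rw [← sub_eq_add_neg]
    exact hn k (hAI k (hk.mono (inter_subset_inter_left _ hBA)))
  · filter_upwards [hI'] with n hn
    refine norm_comp_indicatorLpCLM_le hpT hA.compl (hqmp (-n))
      (coeFn_zpow_composition he he' hT (-n)) (hD n) fun B hB hBA => ?_
    rw [hpre, neg_neg]
    refine measure_zpow_image_le hm hWm hW0 hWfin hcover hdisj hK0 hKT hbd hB fun k hk => ?_
    exact hn k (hAI' k (hk.mono (inter_subset_inter_left _ hBA)))

end Composition

/-- Theorem SC1: if one of Conditions 𝓗𝓒, 𝓗𝓓 or 𝓖𝓗 holds, then `T_f` is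
strongly structurally stable. -/
theorem stmt_12
    {X : Type*} [MeasurableSpace X] (μ : MeasureTheory.Measure X) [MeasureTheory.SigmaFinite μ]
    (p : ℝ≥0∞) (hp1 : 1 ≤ p) (hpT : p ≠ ⊤)
    (e : Equiv.Perm X) (he : Measurable e) (he' : Measurable e.symm)
    (c c' : ℝ≥0∞) (hc : 0 < c) (hcT : c ≠ ⊤) (hc' : 0 < c') (hc'T : c' ≠ ⊤)
    (hb : ∀ B : Set X, MeasurableSet B → μ (⇑e ⁻¹' B) ≤ c * μ B)
    (hb' : ∀ B : Set X, MeasurableSet B → μ (⇑e '' B) ≤ c' * μ B)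
    (W : Set X) (hWm : MeasurableSet W) (hW0 : 0 < μ W) (hWfin : μ W ≠ ⊤)
    (hcover : (⋃ k : ℤ, ⇑(e ^ k) '' W) = Set.univ)
    (hdisj : Pairwise (fun k l : ℤ => Disjoint (⇑(e ^ k) '' W) (⇑(e ^ l) '' W)))
    (K : ℝ≥0∞) (hK0 : 0 < K) (hKT : K ≠ ⊤)
    (hbd : ∀ (k : ℤ) (B : Set X), MeasurableSet B → B ⊆ W →
        K⁻¹ * (μ (⇑(e ^ k) '' W) * μ B) ≤ μ (⇑(e ^ k) '' B) * μ W ∧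
        μ (⇑(e ^ k) '' B) * μ W ≤ K * (μ (⇑(e ^ k) '' W) * μ B))
    [Fact (1 ≤ p)]
    (T : MeasureTheory.Lp ℂ p μ ≃L[ℂ] MeasureTheory.Lp ℂ p μ)
    (hT : ∀ φ : MeasureTheory.Lp ℂ p μ, (T φ : X → ℂ) =ᵐ[μ] fun x => φ (e x))
    (hcond :
      -- 𝓗𝓒
      (Filter.limsup
        (fun n : ℕ => ⨆ k : ℤ,
          (μ (⇑(e ^ k) '' W) / μ (⇑(e ^ (k + (n : ℤ))) '' W)) ^ (1 / (n : ℝ)))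
        Filter.atTop < 1) ∨
      -- 𝓗𝓓
      (1 < Filter.liminf
        (fun n : ℕ => ⨅ k : ℤ,
          (μ (⇑(e ^ k) '' W) / μ (⇑(e ^ (k + (n : ℤ))) '' W)) ^ (1 / (n : ℝ)))
        Filter.atTop) ∨
      -- 𝓖𝓗
      ((Filter.limsup
        (fun n : ℕ => ⨆ k ∈ Set.Iic (0 : ℤ),
          (μ (⇑(e ^ (k - (n : ℤ))) '' W) / μ (⇑(e ^ k) '' W)) ^ (1 / (n : ℝ)))
        Filter.atTop < 1) ∧
       (1 < Filter.liminf
        (fun n : ℕ => ⨅ k ∈ Set.Ici (0 : ℤ),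
          (μ (⇑(e ^ k) '' W) / μ (⇑(e ^ (k + (n : ℤ))) '' W)) ^ (1 / (n : ℝ)))
        Filter.atTop))) :
    StronglyStructurallyStable T := by
  have hqe : Measure.QuasiMeasurePreserving e μ μ := ⟨he, Measure.AbsolutelyContinuous.mk
    fun B hB h0 => by
      rw [Measure.map_apply he hB]
      simpa [h0] using hb B hB⟩
  have hqe' : Measure.QuasiMeasurePreserving e.symm μ μ := ⟨he', Measure.AbsolutelyContinuous.mk
    fun B hB h0 => by
      rw [Measure.map_apply he' hB, ← Equiv.image_eq_preimage_symm]
      simpa [h0] using hb' B hB⟩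
  have hqmp := quasiMeasurePreserving_zpow hqe hqe'
  have hm : ∀ (n : ℤ) (B : Set X), MeasurableSet B → MeasurableSet (⇑(e ^ n) '' B) :=
    fun n B hB => by
      rw [Equiv.image_eq_preimage_symm, ← Equiv.Perm.inv_def, ← zpow_neg]
      exact (hqmp (-n)).measurable hB
  have ha0 : ∀ k : ℤ, μ (⇑(e ^ k) '' W) ≠ 0 := fun k h => by
    have := (hqmp k).preimage_null h
    rw [preimage_image_eq _ (e ^ k).injective] at this
    exact hW0.ne' this
  have haT : ∀ k : ℤ, μ (⇑(e ^ k) '' W) ≠ ⊤ :=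
    measure_zpow_image_ne_top hcT hc'T hm hb hb' hWm hWfin
  have main := fun (I : Set ℤ) (r : ℝ≥0∞) => stronglyStructurallyStable_of_geometric_decay hpT
    hqe hqe' hWm hW0 hWfin hcover hdisj hK0 hKT hbd hT I (r := r)
  rcases hcond with h | h | ⟨h, h'⟩
  · obtain ⟨r, hr, hr1⟩ := exists_between h
    refine main univ r hr1 ?_ (by simp)
    filter_upwards [eventually_lt_of_limsup_lt hr, eventually_ne_atTop 0] with n hn hn0 k _
    have hk := (le_iSup _ (k - (n : ℤ))).trans hn.le
    rw [sub_add_cancel] at hk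
    exact le_pow_mul_of_div_rpow_le (ha0 _) (haT _) hn0 hk
  · obtain ⟨R, hR1, hR⟩ := exists_between h
    refine main ∅ R⁻¹ (ENNReal.inv_lt_one.2 hR1) (by simp) ?_
    filter_upwards [eventually_lt_of_lt_liminf hR, eventually_ne_atTop 0] with n hn hn0 k _
    exact le_inv_pow_mul_of_le_div_rpow (ha0 _) (haT _) (zero_lt_one.trans hR1).ne'
      (hR.trans_le le_top).ne hn0 (hn.le.trans (iInf_le _ k))
  · obtain ⟨r, hr, hr1⟩ := exists_between h
    obtain ⟨R, hR1, hR⟩ := exists_between h'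
    refine main (Iic 0) (max r R⁻¹) (max_lt hr1 (ENNReal.inv_lt_one.2 hR1)) ?_ ?_
    · filter_upwards [eventually_lt_of_limsup_lt hr, eventually_ne_atTop 0] with n hn hn0 k hk
      refine (le_pow_mul_of_div_rpow_le (ha0 _) (haT _) hn0
        ((le_iSup₂ (f := fun (k : ℤ) (_ : k ∈ Iic (0 : ℤ)) =>
          (μ (⇑(e ^ (k - (n : ℤ))) '' W) / μ (⇑(e ^ k) '' W)) ^ (1 / (n : ℝ))) k hk).trans
            hn.le)).trans ?_
      gcongr
      exact le_max_left _ _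
    · filter_upwards [eventually_lt_of_lt_liminf hR, eventually_ne_atTop 0] with n hn hn0 k hk
      have hk0 : k ∈ Ici (0 : ℤ) := mem_Ici.2 (not_le.1 hk).le
      refine (le_inv_pow_mul_of_le_div_rpow (ha0 _) (haT _) (zero_lt_one.trans hR1).ne'
        (hR.trans_le le_top).ne hn0 (hn.le.trans (iInf₂_le k hk0))).trans ?_
      gcongr
      exact le_max_right _ _
end

section
/- Let $(X,\mathcal{B},\mu,f,T_f)$ be a dissipative composition dynamical system of bounded distortion generated by $W$, with $T_f$ invertible on $L^p(X)$, and assume $\sup_{n\in\mathbb{N}}\mu(f^{-n}(W))=\infty$. Then $T_f$ is strongly structurally stable if and only if $T_f$ has the shadowing property. -/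
open MeasureTheory Filter Set ENNReal

/-- The shadowing property for an invertible operator. -/
def HasShadowing {E : Type*} [NormedAddCommGroup E]
    [NormedSpace ℂ E] (T : E ≃L[ℂ] E) : Prop :=
  ∀ ε : ℝ, 0 < ε → ∃ δ : ℝ, 0 < δ ∧ ∀ x : ℤ → E,
    (∀ n : ℤ, ‖T (x n) - x (n + 1)‖ ≤ δ) →
    ∃ y : E, ∀ n : ℤ, ‖(T ^ n) y - x n‖ < ε

section Abstract

variable {E : Type*} [NormedAddCommGroup E] [NormedSpace ℂ E]

theorem summable_of_half_shift {f : ℕ → ℝ} (hf : ∀ n, 0 ≤ f n) (N : ℕ)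
    (h : ∀ n, f (n + N) ≤ 1 / 2 * f n) : Summable f := by
  refine summable_of_sum_range_le (c := 2 * ∑ i ∈ Finset.range N, f i) hf fun n => ?_
  have h1 : ∑ i ∈ Finset.range (N + n), f i
      = ∑ i ∈ Finset.range N, f i + ∑ i ∈ Finset.range n, f (N + i) :=
    Finset.sum_range_add _ _ _
  have h2 : ∑ i ∈ Finset.range n, f (N + i) ≤ 1 / 2 * ∑ i ∈ Finset.range n, f i := by
    rw [Finset.mul_sum]
    exact Finset.sum_le_sum fun i _ => by rw [add_comm]; exact h i
  have h3 : ∑ i ∈ Finset.range n, f i ≤ ∑ i ∈ Finset.range (N + n), f i :=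
    Finset.sum_le_sum_of_subset_of_nonneg (Finset.range_mono (by omega)) fun i _ _ => hf i
  linarith

theorem summable_norm_pow_of_norm_pow_le_half (A : E →L[ℂ] E) (N : ℕ) (h : ‖A ^ N‖ ≤ 1 / 2) :
    Summable fun n : ℕ => ‖A ^ n‖ := by
  refine summable_of_half_shift (fun n => norm_nonneg _) N fun n => ?_
  calc ‖A ^ (n + N)‖ = ‖A ^ N * A ^ n‖ := by rw [add_comm, pow_add]
    _ ≤ ‖A ^ N‖ * ‖A ^ n‖ := norm_mul_le _ _
    _ ≤ _ := by gcongr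

/-- The bounded solution `∑ⱼ A ^ (j + 1) (d j)` at time `0` of `A⁻¹ (z n) = d n + z (n + 1)`. -/
noncomputable def backwardSum (A : E →L[ℂ] E) (d : ℕ → E) : E := ∑' j : ℕ, (A ^ (j + 1)) (d j)

/-- The constant controlling `backwardSum`. -/
noncomputable def powNormSum (A : E →L[ℂ] E) : ℝ := ∑' j : ℕ, ‖A ^ (j + 1)‖

theorem powNormSum_nonneg (A : E →L[ℂ] E) : 0 ≤ powNormSum A :=
  tsum_nonneg fun _ => norm_nonneg _

theorem norm_pow_succ_apply_le (A : E →L[ℂ] E) {d : ℕ → E} {D : ℝ} (hd : ∀ j, ‖d j‖ ≤ D) (j : ℕ) :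
    ‖(A ^ (j + 1)) (d j)‖ ≤ ‖A ^ (j + 1)‖ * D :=
  ((A ^ (j + 1)).le_opNorm _).trans (by gcongr; exact hd j)

theorem summable_norm_pow_succ_mul {A : E →L[ℂ] E} (hA : Summable fun n : ℕ => ‖A ^ n‖) (D : ℝ) :
    Summable fun j : ℕ => ‖A ^ (j + 1)‖ * D :=
  ((summable_nat_add_iff 1).2 hA).mul_right D

theorem norm_backwardSum_le {A : E →L[ℂ] E} (hA : Summable fun n : ℕ => ‖A ^ n‖)
    {d : ℕ → E} {D : ℝ} (hd : ∀ j, ‖d j‖ ≤ D) : ‖backwardSum A d‖ ≤ powNormSum A * D := by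
  have hs := summable_norm_pow_succ_mul hA D
  rw [powNormSum, ← tsum_mul_right]
  exact tsum_of_norm_bounded hs.hasSum (norm_pow_succ_apply_le A hd)

theorem summable_backward [CompleteSpace E] {A : E →L[ℂ] E} (hA : Summable fun n : ℕ => ‖A ^ n‖)
    {d : ℕ → E} {D : ℝ} (hd : ∀ j, ‖d j‖ ≤ D) : Summable fun j : ℕ => (A ^ (j + 1)) (d j) :=
  Summable.of_norm_bounded (summable_norm_pow_succ_mul hA D) (norm_pow_succ_apply_le A hd)

theorem backwardSum_sub [CompleteSpace E] {A : E →L[ℂ] E} (hA : Summable fun n : ℕ => ‖A ^ n‖)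
    {d d' : ℕ → E} {D : ℝ} (hd : ∀ j, ‖d j‖ ≤ D) (hd' : ∀ j, ‖d' j‖ ≤ D) :
    backwardSum A d - backwardSum A d' = backwardSum A (fun j => d j - d' j) := by
  simp only [backwardSum, map_sub]
  exact ((summable_backward hA hd).tsum_sub (summable_backward hA hd')).symm

theorem continuous_backwardSum [CompleteSpace E] {A : E →L[ℂ] E} (hA : Summable fun n : ℕ => ‖A ^ n‖)
    {c : ℕ → E → E} (hc : ∀ j, Continuous (c j)) {D : ℝ} (hD : ∀ j x, ‖c j x‖ ≤ D) :
    Continuous fun x => backwardSum A fun j => c j x :=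
  continuous_tsum (fun j => (A ^ (j + 1)).continuous.comp (hc j))
    (summable_norm_pow_succ_mul hA D)
    fun j x => norm_pow_succ_apply_le A (d := fun j => c j x) (fun j => hD j x) j

theorem apply_backwardSum [CompleteSpace E] (T : E ≃L[ℂ] E)
    (hA : Summable fun n : ℕ => ‖(T.symm : E →L[ℂ] E) ^ n‖) {d : ℕ → E} {D : ℝ}
    (hd : ∀ j, ‖d j‖ ≤ D) :
    T (backwardSum (T.symm : E →L[ℂ] E) d)
      = d 0 + backwardSum (T.symm : E →L[ℂ] E) (fun j => d (j + 1)) := by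
  have key : backwardSum (T.symm : E →L[ℂ] E) d
      = T.symm (d 0 + backwardSum (T.symm : E →L[ℂ] E) (fun j => d (j + 1))) := by
    rw [backwardSum, (summable_backward hA hd).tsum_eq_zero_add, map_add, backwardSum]
    have hs := summable_backward hA (d := fun j => d (j + 1)) (fun j => hd (j + 1))
    have := (T.symm : E →L[ℂ] E).map_tsum hs
    simp only [ContinuousLinearEquiv.coe_coe] at this
    rw [this]
    simp [pow_succ' _ (_ + 1)]
  rw [key, T.apply_symm_apply]

theorem zpow_add_one_apply (T : E ≃L[ℂ] E) (n : ℤ) (y : E) : (T ^ (n + 1)) y = T ((T ^ n) y) := by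
  rw [add_comm, zpow_one_add]; rfl

theorem zpow_natCast_apply (T : E ≃L[ℂ] E) (n : ℕ) (y : E) : (T ^ (n : ℤ)) y = T^[n] y := by
  induction n with
  | zero => rfl
  | succ n ih => rw [Nat.cast_succ, zpow_add_one_apply, ih, Function.iterate_succ_apply']

theorem symm_pow_iterate (T : E ≃L[ℂ] E) (n : ℕ) (y : E) :
    ((T.symm : E →L[ℂ] E) ^ n) (T^[n] y) = y := by
  induction n with
  | zero => rfl
  | succ n ih => rw [pow_succ, Function.iterate_succ_apply']; simpa using ih

theorem hasShadowing_of_summable [CompleteSpace E] (T : E ≃L[ℂ] E)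
    (hA : Summable fun n : ℕ => ‖(T.symm : E →L[ℂ] E) ^ n‖) : HasShadowing T := by
  intro ε hε
  set A : E →L[ℂ] E := (T.symm : E →L[ℂ] E)
  have hσ := powNormSum_nonneg A
  refine ⟨ε / (powNormSum A + 1), by positivity, fun x hx => ?_⟩
  set d : ℤ → E := fun n => x (n + 1) - T (x n) with hd
  have hdb : ∀ n, ‖d n‖ ≤ ε / (powNormSum A + 1) := fun n => by
    rw [hd, norm_sub_rev]; exact hx n
  set z : ℤ → E := fun n => backwardSum A fun j => d (n + j) with hz
  have hzT : ∀ n, T (z n) = d n + z (n + 1) := fun n => by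
    have := apply_backwardSum T hA (d := fun j => d (n + j)) (fun j => hdb _)
    rw [hz, this]
    simp only [Nat.cast_zero, add_zero, Nat.cast_add, Nat.cast_one]
    congr 2
    ext j
    congr 1
    ring
  have hstep : ∀ n, T (x n + z n) = x (n + 1) + z (n + 1) := fun n => by
    have : T (x n) + d n = x (n + 1) := add_sub_cancel _ _
    rw [map_add, hzT, ← add_assoc, this]
  have horb : ∀ n : ℤ, (T ^ n) (x 0 + z 0) = x n + z n := by
    intro n
    induction n with
    | zero => rfl
    | succ n ih => rw [zpow_add_one_apply, ih, hstep]
    | pred n ih =>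
      apply T.injective
      rw [← zpow_add_one_apply, hstep, sub_add_cancel, ih]
  refine ⟨x 0 + z 0, fun n => ?_⟩
  rw [horb, add_sub_cancel_left]
  calc ‖z n‖ ≤ powNormSum A * (ε / (powNormSum A + 1)) := norm_backwardSum_le hA fun j => hdb _
    _ < ε := by
      rw [mul_div_assoc', div_lt_iff₀ (by positivity)]
      nlinarith

theorem tendsto_norm_pow_mul {A : E →L[ℂ] E} (hA : Summable fun n : ℕ => ‖A ^ n‖) (B : ℝ) :
    Tendsto (fun n : ℕ => ‖A ^ n‖ * B) atTop (nhds 0) := by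
  simpa using hA.tendsto_atTop_zero.mul_const B

theorem eq_zero_of_bounded_forward_orbit (T : E ≃L[ℂ] E)
    (hA : Summable fun n : ℕ => ‖(T.symm : E →L[ℂ] E) ^ n‖) {y : E} {B : ℝ}
    (hB : ∀ n : ℕ, ‖T^[n] y‖ ≤ B) : y = 0 := by
  refine norm_le_zero_iff.1 (ge_of_tendsto' (tendsto_norm_pow_mul hA B) fun n => ?_)
  calc ‖y‖ = ‖((T.symm : E →L[ℂ] E) ^ n) (T^[n] y)‖ := by rw [symm_pow_iterate]
    _ ≤ _ := ((_ : E →L[ℂ] E).le_opNorm _).trans (by gcongr; exact hB n)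

/-- A bounded solution of `T (d n) = d (n + 1) - r n` is controlled by `r`. -/
theorem norm_le_of_bounded_solution [CompleteSpace E] (T : E ≃L[ℂ] E)
    (hA : Summable fun n : ℕ => ‖(T.symm : E →L[ℂ] E) ^ n‖) {d r : ℕ → E} {B R : ℝ}
    (hd : ∀ n, T (d n) = d (n + 1) + r n) (hB : ∀ n, ‖d n‖ ≤ B) (hR : ∀ n, ‖r n‖ ≤ R) (n : ℕ) :
    ‖d n‖ ≤ powNormSum (T.symm : E →L[ℂ] E) * R := by
  set A : E →L[ℂ] E := (T.symm : E →L[ℂ] E)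
  set z : ℕ → E := fun n => backwardSum A fun j => r (n + j) with hz
  have hzb : ∀ n, ‖z n‖ ≤ powNormSum A * R := fun n => norm_backwardSum_le hA fun j => hR _
  have hzT : ∀ n, T (z n) = r n + z (n + 1) := fun n => by
    have := apply_backwardSum T hA (d := fun j => r (n + j)) (fun j => hR _)
    rw [hz, this]
    simp only [add_zero]
    congr 2
    ext j
    congr 1
    ring
  have horb : ∀ m, T^[m] (d n - z n) = d (n + m) - z (n + m) := by
    intro m
    induction m with
    | zero => rfl
    | succ m ih =>
      rw [Function.iterate_succ_apply', ih, map_sub, hd, hzT, ← add_assoc]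
      abel
  have h0 : d n - z n = 0 :=
    eq_zero_of_bounded_forward_orbit T hA (B := B + powNormSum A * R) fun m => by
      rw [horb]; exact (norm_sub_le _ _).trans (add_le_add (hB _) (hzb _))
  rw [sub_eq_zero.1 h0]
  exact hzb n

theorem eq_of_bounded_perturbed_orbits [CompleteSpace E] (T : E ≃L[ℂ] E)
    (hA : Summable fun n : ℕ => ‖(T.symm : E →L[ℂ] E) ^ n‖) {φ : E → E} {ε : ℝ} (hε : 0 < ε)
    (hφ : LipschitzWith (Real.toNNReal ε) φ)
    (hεσ : powNormSum (T.symm : E →L[ℂ] E) * ε ≤ 1 / 2) {x y : ℕ → E} {B : ℝ}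
    (hx : ∀ n, x (n + 1) = T (x n) + φ (x n)) (hy : ∀ n, y (n + 1) = T (y n) + φ (y n))
    (hB : ∀ n, ‖x n - y n‖ ≤ B) : x 0 = y 0 := by
  have hlip : ∀ a b, ‖φ a - φ b‖ ≤ ε * ‖a - b‖ := fun a b => by
    simpa [hε.le] using hφ.norm_sub_le a b
  have hhalf : ∀ m : ℕ, ∀ n, ‖x n - y n‖ ≤ (1 / 2) ^ m * B := by
    intro m
    induction m with
    | zero => simpa using hB
    | succ m ih =>
      intro n
      have hB0 : 0 ≤ (1 / 2) ^ m * B := (norm_nonneg _).trans (ih 0)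
      have := norm_le_of_bounded_solution T hA (d := fun n => x n - y n)
        (r := fun n => -(φ (x n) - φ (y n))) (B := B) (R := ε * ((1 / 2) ^ m * B))
        (fun n => by simp only [hx, hy, map_sub]; abel) hB
        (fun n => by rw [norm_neg]; exact (hlip _ _).trans (by gcongr; exact ih n)) n
      calc ‖x n - y n‖ ≤ _ := this
        _ = (powNormSum (T.symm : E →L[ℂ] E) * ε) * ((1 / 2) ^ m * B) := by ring
        _ ≤ 1 / 2 * ((1 / 2) ^ m * B) := by gcongr
        _ = _ := by ring
  have hlim : Tendsto (fun m : ℕ => (1 / 2 : ℝ) ^ m * B) atTop (nhds 0) := by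
    simpa using (tendsto_pow_atTop_nhds_zero_of_lt_one (by norm_num : (0 : ℝ) ≤ 1 / 2)
      (by norm_num)).mul_const B
  exact sub_eq_zero.1 (norm_le_zero_iff.1 (ge_of_tendsto' hlim fun m => hhalf m 0))

open scoped BoundedContinuousFunction in
theorem exists_semiconj [CompleteSpace E] (T : E ≃L[ℂ] E)
    (hA : Summable fun n : ℕ => ‖(T.symm : E →L[ℂ] E) ^ n‖) {φ : E → E} {ε : ℝ} (hε : 0 < ε)
    (hφb : ∀ x, ‖φ x‖ ≤ ε) (hφ : LipschitzWith (Real.toNNReal ε) φ)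
    (hεσ : powNormSum (T.symm : E →L[ℂ] E) * ε ≤ 1 / 2) :
    ∃ h : E → E, Continuous h ∧ (∀ x, h (T x) = T (h x) + φ (h x)) ∧
      ∀ x, ‖h x - x‖ ≤ powNormSum (T.symm : E →L[ℂ] E) * ε := by
  set A : E →L[ℂ] E := (T.symm : E →L[ℂ] E)
  have hTc : ∀ j, Continuous (T^[j]) := fun j => T.continuous.iterate j
  have hb : ∀ (u : E → E) x, ‖-backwardSum A fun j => φ (T^[j] x + u (T^[j] x))‖
      ≤ powNormSum A * ε := fun u x => by
    rw [norm_neg]; exact norm_backwardSum_le hA fun j => hφb _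
  let F : (E →ᵇ E) → (E →ᵇ E) := fun u =>
    BoundedContinuousFunction.ofNormedAddCommGroup
      (fun x => -backwardSum A fun j => φ (T^[j] x + u (T^[j] x)))
      (continuous_backwardSum hA (c := fun j x => φ (T^[j] x + u (T^[j] x)))
        (fun j => hφ.continuous.comp ((hTc j).add (u.continuous.comp (hTc j))))
        (fun j x => hφb _)).neg
      (powNormSum A * ε) (hb u)
  have hF : ContractingWith (1 / 2) F := by
    refine ⟨by rw [← NNReal.coe_lt_coe]; norm_num, LipschitzWith.of_dist_le_mul fun u v => ?_⟩
    refine (BoundedContinuousFunction.dist_le (by positivity)).2 fun x => ?_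
    have h1 : F u x - F v x = -(backwardSum A (fun j => φ (T^[j] x + u (T^[j] x))) -
        backwardSum A (fun j => φ (T^[j] x + v (T^[j] x)))) := by
      simp only [F, BoundedContinuousFunction.coe_ofNormedAddCommGroup]; abel
    rw [dist_eq_norm, h1, norm_neg, backwardSum_sub hA (D := ε) (fun j => hφb _) (fun j => hφb _)]
    calc _ ≤ powNormSum A * (ε * dist u v) := norm_backwardSum_le hA fun j => by
            have := hφ.norm_sub_le (T^[j] x + u (T^[j] x)) (T^[j] x + v (T^[j] x))
            rw [add_sub_add_left_eq_sub, Real.coe_toNNReal _ hε.le, ← dist_eq_norm (u _)] at this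
            exact this.trans (by gcongr; exact BoundedContinuousFunction.dist_coe_le_dist _)
      _ = (powNormSum A * ε) * dist u v := by ring
      _ ≤ 1 / 2 * dist u v := by gcongr
      _ = _ := by norm_num
  set u := ContractingWith.fixedPoint F hF
  have hfix : ∀ x, u x = -backwardSum A fun j => φ (T^[j] x + u (T^[j] x)) := fun x =>
    (congrArg (fun w : E →ᵇ E => w x) hF.fixedPoint_isFixedPt.symm)
  refine ⟨fun x => x + u x, continuous_id.add u.continuous, fun x => ?_, fun x => ?_⟩
  · have h1 : T (u x) = -(φ (x + u x) + -u (T x)) := by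
      rw [hfix (T x), neg_neg]
      conv_lhs => rw [hfix x, map_neg, apply_backwardSum T hA (fun j => hφb _)]
      rfl
    simp only [map_add, h1]
    abel
  · rw [add_sub_cancel_left, hfix]
    exact hb _ _

theorem exists_semiconj' [CompleteSpace E] (T : E ≃L[ℂ] E)
    (hA : Summable fun n : ℕ => ‖(T.symm : E →L[ℂ] E) ^ n‖) {φ : E → E} {ε : ℝ}
    (hφb : ∀ x, ‖φ x‖ ≤ ε) (hφ : Continuous φ) :
    ∃ g : E → E, Continuous g ∧ (∀ x, g (T x + φ x) = T (g x)) ∧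
      ∀ x, ‖g x - x‖ ≤ powNormSum (T.symm : E →L[ℂ] E) * ε := by
  set A : E →L[ℂ] E := (T.symm : E →L[ℂ] E)
  set S : E → E := fun x => T x + φ x
  have hSc : ∀ j, Continuous (S^[j]) := fun j => (T.continuous.add hφ).iterate j
  refine ⟨fun x => x + backwardSum A fun j => φ (S^[j] x),
    continuous_id.add (continuous_backwardSum hA (c := fun j x => φ (S^[j] x))
      (fun j => hφ.comp (hSc j)) (fun j x => hφb _)), fun x => ?_, fun x => ?_⟩
  · simp only [map_add]
    rw [apply_backwardSum T hA (fun j => hφb _), ← add_assoc]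
    rfl
  · rw [add_sub_cancel_left]
    exact norm_backwardSum_le hA fun j => hφb _

theorem stronglyStructurallyStable_of_summable_s15 [CompleteSpace E] (T : E ≃L[ℂ] E)
    (hA : Summable fun n : ℕ => ‖(T.symm : E →L[ℂ] E) ^ n‖) : StronglyStructurallyStable T := by
  intro γ hγ
  set σ := powNormSum (T.symm : E →L[ℂ] E)
  have hσ : 0 ≤ σ := powNormSum_nonneg _
  have hm : 0 < min γ (1 / 2) := lt_min hγ (by norm_num)
  set ε := min γ (1 / 2) / (σ + 1) with hεdef
  have hε : 0 < ε := by positivity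
  have hσε : σ * ε ≤ min γ (1 / 2) := by
    rw [hεdef, mul_div_assoc', div_le_iff₀ (by positivity)]
    nlinarith
  have hσε' : σ * ε ≤ 1 / 2 := hσε.trans (min_le_right _ _)
  refine ⟨ε, hε, fun φ hφc hφb hφ => ?_⟩
  obtain ⟨h, hhc, hhT, hhb⟩ := exists_semiconj T hA hε hφb hφ hσε'
  obtain ⟨g, hgc, hgT, hgb⟩ := exists_semiconj' T hA hφb hφc
  have hgh : ∀ x, g (h x) = x := fun x => by
    have horb : ∀ n, T^[n] (g (h x) - x) = g (h (T^[n] x)) - T^[n] x := by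
      intro n
      induction n with
      | zero => rfl
      | succ n ih =>
        rw [Function.iterate_succ_apply', ih, map_sub, ← hgT, ← hhT, Function.iterate_succ_apply']
    refine sub_eq_zero.1 (eq_zero_of_bounded_forward_orbit T hA (B := σ * ε + σ * ε) fun n => ?_)
    rw [horb, ← sub_add_sub_cancel _ (h (T^[n] x))]
    exact (norm_add_le _ _).trans (add_le_add (hgb _) (hhb _))
  have hhg : ∀ y, h (g y) = y := fun y => by
    set S : E → E := fun x => T x + φ x
    refine eq_of_bounded_perturbed_orbits T hA hε hφ hσε' (x := fun n => h (g (S^[n] y)))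
      (y := fun n => S^[n] y) (B := σ * ε + σ * ε) (fun n => ?_) (fun n => ?_) (fun n => ?_)
    · simp only [Function.iterate_succ_apply']
      rw [← hhT, ← hgT]
    · simp only [Function.iterate_succ_apply']
      rfl
    · rw [← sub_add_sub_cancel _ (g (S^[n] y))]
      exact (norm_add_le _ _).trans (add_le_add (hhb _) (hgb _))
  exact ⟨⟨⟨h, g, hgh, hhg⟩, hhc, hgc⟩, hhT, fun x => (hhb x).trans (hσε.trans (min_le_left _ _))⟩

theorem exists_bounded_solution_of_small (T : E ≃L[ℂ] E) {ε : ℝ} (hε : 0 < ε)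
    (h : ∀ v : E, ‖v‖ ≤ ε → ∃ z, z = T z + v ∧ ‖z‖ ≤ 1) :
    ∀ v : E, ∃ z, z = T z + v ∧ ‖z‖ ≤ ε⁻¹ * ‖v‖ := by
  intro v
  rcases eq_or_ne v 0 with rfl | hv
  · exact ⟨0, by simp⟩
  have hv' : 0 < ‖v‖ := norm_pos_iff.2 hv
  set c : ℂ := ((ε / ‖v‖ : ℝ) : ℂ) with hc
  have hcn : ‖c‖ = ε / ‖v‖ := by
    rw [hc, Complex.norm_real, Real.norm_of_nonneg (by positivity)]
  have hc0 : c ≠ 0 := by rw [← norm_pos_iff, hcn]; positivity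
  obtain ⟨z, hz, hzb⟩ := h (c • v) (by rw [norm_smul, hcn]; field_simp; exact le_rfl)
  refine ⟨c⁻¹ • z, ?_, ?_⟩
  · nth_rewrite 1 [hz]
    rw [smul_add, smul_smul, inv_mul_cancel₀ hc0, one_smul, map_smul]
  · rw [norm_smul, norm_inv, hcn, inv_div]
    calc ‖v‖ / ε * ‖z‖ ≤ ‖v‖ / ε * 1 := by gcongr
      _ = ε⁻¹ * ‖v‖ := by ring

theorem StronglyStructurallyStable.exists_bounded_solution {T : E ≃L[ℂ] E}
    (h : StronglyStructurallyStable T) :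
    ∃ M : ℝ, ∀ v : E, ∃ z, z = T z + v ∧ ‖z‖ ≤ M * ‖v‖ := by
  obtain ⟨ε, hε, H⟩ := h 1 one_pos
  refine ⟨ε⁻¹, exists_bounded_solution_of_small T hε fun v hv => ?_⟩
  obtain ⟨g, hg, hgb⟩ := H (fun _ => v) continuous_const (fun _ => hv)
    ((LipschitzWith.const v).weaken zero_le)
  exact ⟨g 0, by simpa using hg 0, by simpa using hgb 0⟩

theorem HasShadowing.exists_bounded_solution {T : E ≃L[ℂ] E} (h : HasShadowing T)
    (hexp : ∀ (y : E) (B : ℝ), (∀ n : ℕ, ‖T^[n] y‖ ≤ B) → y = 0) :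
    ∃ M : ℝ, ∀ v : E, ∃ z, z = T z + v ∧ ‖z‖ ≤ M * ‖v‖ := by
  obtain ⟨δ, hδ, H⟩ := h 1 one_pos
  refine ⟨δ⁻¹, exists_bounded_solution_of_small T hδ fun v hv => ?_⟩
  let G : Equiv.Perm E := T.toEquiv.trans (Equiv.addRight v)
  have hG : ∀ n : ℤ, (G ^ (n + 1)) 0 = T ((G ^ n) 0) + v := fun n => by
    rw [add_comm, zpow_one_add]; rfl
  obtain ⟨y, hy⟩ := H (fun n => (G ^ n) 0) fun n => by
    rw [hG, sub_add_cancel_left, norm_neg]; exact hv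
  set z : ℤ → E := fun n => (G ^ n) 0 - (T ^ n) y with hz
  have hzb : ∀ n, ‖z n‖ ≤ 1 := fun n => by rw [hz, norm_sub_rev]; exact (hy n).le
  have hzT : ∀ n, z (n + 1) = T (z n) + v := fun n => by
    simp only [hz, hG, zpow_add_one_apply, map_sub]; abel
  have horb : ∀ n : ℕ, T^[n] (z 1 - z 0) = z (n + 1) - z n := by
    intro n
    induction n with
    | zero => simp
    | succ n ih =>
      rw [Function.iterate_succ_apply', ih, map_sub, Nat.cast_succ, hzT (n + 1), hzT n]
      abel
  have h0 := hexp (z 1 - z 0) 2 fun n => by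
    rw [horb]
    exact (norm_sub_le _ _).trans (by linarith [hzb (n + 1), hzb n])
  refine ⟨z 0, ?_, hzb 0⟩
  rw [← hzT 0, zero_add]
  exact (sub_eq_zero.1 h0).symm

end Abstract

section Composition

theorem preimage_zpow_preimage {X : Type*} (e : Equiv.Perm X) (a b : ℤ) (B : Set X) :
    ⇑(e ^ a) ⁻¹' (⇑(e ^ b) ⁻¹' B) = ⇑(e ^ (b + a)) ⁻¹' B := by
  rw [zpow_add]; rfl

theorem perm_zpow_add_apply {X : Type*} (e : Equiv.Perm X) (a b : ℤ) (x : X) :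
    (e ^ (a + b)) x = (e ^ a) ((e ^ b) x) := by
  rw [zpow_add]; rfl

theorem perm_zpow_add_one_apply {X : Type*} (e : Equiv.Perm X) (a : ℤ) (x : X) :
    (e ^ (a + 1)) x = e ((e ^ a) x) := by
  rw [add_comm, perm_zpow_add_apply, zpow_one]

theorem image_zpow_eq_preimage {X : Type*} (e : Equiv.Perm X) (k : ℤ) (B : Set X) :
    ⇑(e ^ k) '' B = ⇑(e ^ (-k)) ⁻¹' B := by
  rw [zpow_neg, Equiv.image_eq_preimage_symm]; rfl

variable {X : Type*} [MeasurableSpace X] {μ : Measure X} {e : Equiv.Perm X}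

/-- Every iterate of `e`, forward or backward, is measurable and increases the measure of preimages
by at most a constant factor. -/
def BoundedlyNonsingular (μ : Measure X) (e : Equiv.Perm X) : Prop :=
  ∀ k : ℤ, Measurable ⇑(e ^ k) ∧
    ∃ C : ℝ≥0∞, C ≠ ⊤ ∧ ∀ B, MeasurableSet B → μ (⇑(e ^ k) ⁻¹' B) ≤ C * μ B

theorem boundedlyNonsingular (he : Measurable e) (he' : Measurable e.symm) {c c' : ℝ≥0∞}
    (hcT : c ≠ ⊤) (hc'T : c' ≠ ⊤)
    (hb : ∀ B : Set X, MeasurableSet B → μ (⇑e ⁻¹' B) ≤ c * μ B)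
    (hb' : ∀ B : Set X, MeasurableSet B → μ (⇑e '' B) ≤ c' * μ B) :
    BoundedlyNonsingular μ e := by
  intro k
  induction k with
  | zero => exact ⟨measurable_id, 1, one_ne_top, fun B _ => by simp⟩
  | succ n ih =>
    obtain ⟨hm, C, hC, h⟩ := ih
    have hcomp : ⇑(e ^ ((n : ℤ) + 1)) = ⇑(e ^ (n : ℤ)) ∘ e := by rw [zpow_add_one]; rfl
    refine ⟨hcomp ▸ hm.comp he, c * C, mul_ne_top hcT hC, fun B hB => ?_⟩
    rw [hcomp, preimage_comp, mul_assoc]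
    exact (hb _ (hm hB)).trans (by gcongr; exact h B hB)
  | pred n ih =>
    obtain ⟨hm, C, hC, h⟩ := ih
    have hcomp : ⇑(e ^ (-(n : ℤ) - 1)) = ⇑(e ^ (-(n : ℤ))) ∘ e.symm := by rw [zpow_sub_one]; rfl
    refine ⟨hcomp ▸ hm.comp he', c' * C, mul_ne_top hc'T hC, fun B hB => ?_⟩
    rw [hcomp, preimage_comp, mul_assoc, ← Equiv.image_eq_preimage_symm]
    exact (hb' _ (hm hB)).trans (by gcongr; exact h B hB)

theorem BoundedlyNonsingular.quasiMeasurePreserving (hn : BoundedlyNonsingular μ e) (k : ℤ) :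
    Measure.QuasiMeasurePreserving ⇑(e ^ k) μ μ := by
  obtain ⟨hm, C, -, h⟩ := hn k
  refine ⟨hm, Measure.AbsolutelyContinuous.mk fun B hB h0 => ?_⟩
  rw [Measure.map_apply hm hB]
  simpa [h0] using h B hB

theorem BoundedlyNonsingular.ae_zpow (hn : BoundedlyNonsingular μ e) {P : X → Prop}
    (hP : ∀ᵐ x ∂μ, P x) : ∀ᵐ x ∂μ, ∀ j : ℤ, P ((e ^ j) x) :=
  ae_all_iff.2 fun j => (hn.quasiMeasurePreserving j).ae hP

/-- The wandering set `W` has finite measure and its preimages have unbounded measure, in a way that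
is inherited proportionally by its subsets. -/
structure UnboundedWandering (μ : Measure X) (e : Equiv.Perm X) (W : Set X) : Prop where
  nonsingular : BoundedlyNonsingular μ e
  measurableSet : MeasurableSet W
  measure_ne_top : μ W ≠ ⊤
  cover : ∀ x, ∃ k : ℤ, (e ^ k) x ∈ W
  disjoint : ∀ (x : X) (k l : ℤ), (e ^ k) x ∈ W → (e ^ l) x ∈ W → k = l
  distortion : ∃ K : ℝ≥0∞, K ≠ ⊤ ∧ ∀ (k : ℤ) (B : Set X), MeasurableSet B → B ⊆ W →
    K⁻¹ * (μ (⇑(e ^ k) ⁻¹' W) * μ B) ≤ μ (⇑(e ^ k) ⁻¹' B) * μ W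
  unbounded : (⨆ n : ℕ, μ (⇑(e ^ (n : ℤ)) ⁻¹' W)) = ⊤

namespace UnboundedWandering

variable {W : Set X}

theorem measurableSet_preimage (h : UnboundedWandering μ e W) (k : ℤ) :
    MeasurableSet (⇑(e ^ k) ⁻¹' W) :=
  (h.nonsingular k).1 h.measurableSet

theorem measure_eq_zero (h : UnboundedWandering μ e W) {B : Set X} (hB : MeasurableSet B) {k : ℤ}
    (hBW : B ⊆ ⇑(e ^ k) ⁻¹' W) {M : ℝ≥0∞} (hM : M ≠ ⊤)
    (hBM : ∀ n : ℕ, μ (⇑(e ^ (n : ℤ)) ⁻¹' B) ≤ M) : μ B = 0 := by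
  obtain ⟨K, hK, hd⟩ := h.distortion
  obtain ⟨hm, C, hC, hCB⟩ := h.nonsingular (-k)
  obtain ⟨-, C', -, hCB'⟩ := h.nonsingular k
  set B₀ := ⇑(e ^ (-k)) ⁻¹' B with hB₀
  have hB₀m : MeasurableSet B₀ := hm hB
  have hB₀W : B₀ ⊆ W := by
    refine (preimage_mono hBW).trans ?_
    rw [preimage_zpow_preimage]
    simp
  have hBB₀ : B = ⇑(e ^ k) ⁻¹' B₀ := by rw [hB₀, preimage_zpow_preimage]; simp
  suffices h0 : μ B₀ = 0 by
    rw [hBB₀]; simpa [h0] using hCB' B₀ hB₀m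
  by_contra h0
  have hB₀n : ∀ n : ℕ, μ (⇑(e ^ (n : ℤ)) ⁻¹' B₀) ≤ C * M := fun n => by
    rw [hB₀, preimage_zpow_preimage, add_comm, ← preimage_zpow_preimage]
    exact (hCB _ ((h.nonsingular n).1 hB)).trans (by gcongr; exact hBM n)
  have hc0 : K⁻¹ * μ B₀ ≠ 0 := mul_ne_zero (ENNReal.inv_ne_zero.2 hK) h0
  have hW : ∀ n : ℕ, μ (⇑(e ^ (n : ℤ)) ⁻¹' W) ≤ C * M * μ W / (K⁻¹ * μ B₀) := fun n => by
    refine (ENNReal.le_div_iff_mul_le (Or.inl hc0)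
      (Or.inr (mul_ne_top (mul_ne_top hC hM) h.measure_ne_top))).2 ?_
    calc _ = K⁻¹ * (μ (⇑(e ^ (n : ℤ)) ⁻¹' W) * μ B₀) := by ring
      _ ≤ _ := hd n B₀ hB₀m hB₀W
      _ ≤ _ := by gcongr; exact hB₀n n
  have := iSup_le hW
  rw [h.unbounded] at this
  exact (ENNReal.div_lt_top (mul_ne_top (mul_ne_top hC hM) h.measure_ne_top) hc0).ne
    (top_le_iff.1 this)

theorem ae_eq_zero_on (h : UnboundedWandering μ e W) {g : X → ℂ} (hg : Measurable g) (k : ℤ)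
    (hgM : ∀ t : ℝ≥0∞, t ≠ 0 → ∃ M : ℝ≥0∞, M ≠ ⊤ ∧ ∀ n : ℕ,
      μ {x | t ≤ ‖g ((e ^ (n : ℤ)) x)‖ₑ ∧ (e ^ (k + n)) x ∈ W} ≤ M) :
    ∀ᵐ x ∂μ, (e ^ k) x ∈ W → g x = 0 := by
  have hm : ∀ m : ℕ, ∀ᵐ x ∂μ, ¬ ((m : ℝ≥0∞)⁻¹ ≤ ‖g x‖ₑ ∧ (e ^ k) x ∈ W) := fun m => by
    obtain ⟨M, hM, hn⟩ := hgM (m : ℝ≥0∞)⁻¹ (ENNReal.inv_ne_zero.2 (natCast_ne_top m))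
    rw [ae_iff]
    simp only [not_not]
    refine h.measure_eq_zero (B := {x | (m : ℝ≥0∞)⁻¹ ≤ ‖g x‖ₑ ∧ (e ^ k) x ∈ W}) (k := k)
      ((measurableSet_le measurable_const hg.enorm).inter (h.measurableSet_preimage k))
      (fun x hx => hx.2) hM fun n => ?_
    refine (measure_mono fun x hx => ?_).trans (hn n)
    exact ⟨hx.1, by rw [perm_zpow_add_apply]; exact hx.2⟩
  filter_upwards [ae_all_iff.2 hm] with x hx hxW
  by_contra h0
  obtain ⟨m, hmx⟩ := ENNReal.exists_inv_nat_lt (enorm_ne_zero.2 h0)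
  exact hx m ⟨hmx.le, hxW⟩

end UnboundedWandering

theorem measure_le_enorm_Lp {p : ℝ≥0∞} (hp0 : p ≠ 0) (hpT : p ≠ ⊤) (φ : Lp ℂ p μ) {t : ℝ≥0∞}
    (ht : t ≠ 0) : μ {x | t ≤ ‖φ x‖ₑ} ≤ t⁻¹ ^ p.toReal * ‖φ‖ₑ ^ p.toReal := by
  rw [Lp.enorm_def]
  exact meas_ge_le_mul_pow_eLpNorm_enorm μ hp0 hpT (Lp.aestronglyMeasurable φ) ht (by simp)

variable {p : ℝ≥0∞} [Fact (1 ≤ p)] {T : Lp ℂ p μ ≃L[ℂ] Lp ℂ p μ} {W : Set X}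

theorem iterate_ae_eq (hn : BoundedlyNonsingular μ e)
    (hT : ∀ φ : Lp ℂ p μ, (T φ : X → ℂ) =ᵐ[μ] fun x => φ (e x)) (φ : Lp ℂ p μ) (n : ℕ) :
    (T^[n] φ : X → ℂ) =ᵐ[μ] fun x => φ ((e ^ (n : ℤ)) x) := by
  induction n with
  | zero => simp
  | succ n ih =>
    rw [Function.iterate_succ_apply']
    have := (hn.quasiMeasurePreserving 1).ae ih
    simp only [zpow_one] at this
    filter_upwards [hT (T^[n] φ), this] with x hx h1
    rw [hx, h1, Nat.cast_succ, perm_zpow_add_apply, zpow_one]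

theorem UnboundedWandering.eq_zero_of_bounded_orbit (h : UnboundedWandering μ e W) (hpT : p ≠ ⊤)
    (hT : ∀ φ : Lp ℂ p μ, (T φ : X → ℂ) =ᵐ[μ] fun x => φ (e x)) (w : Lp ℂ p μ) (B : ℝ)
    (hB : ∀ n : ℕ, ‖T^[n] w‖ ≤ B) : w = 0 := by
  have hp0 : p ≠ 0 := (zero_lt_one.trans_le (Fact.out : 1 ≤ p)).ne'
  have h0 : ∀ k : ℤ, ∀ᵐ x ∂μ, (e ^ k) x ∈ W → w x = 0 := fun k => by
    refine h.ae_eq_zero_on (Lp.stronglyMeasurable w).measurable k fun t ht =>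
      ⟨t⁻¹ ^ p.toReal * ENNReal.ofReal B ^ p.toReal, ?_, fun n => ?_⟩
    · exact mul_ne_top (rpow_ne_top_of_nonneg toReal_nonneg (ENNReal.inv_ne_top.2 ht))
        (rpow_ne_top_of_nonneg toReal_nonneg ofReal_ne_top)
    · calc _ ≤ μ {x | t ≤ ‖(T^[n] w : Lp ℂ p μ) x‖ₑ} := by
            refine measure_mono_ae ?_
            filter_upwards [iterate_ae_eq h.nonsingular hT w n] with x hx hxt
            change t ≤ _
            rw [hx]
            exact hxt.1
        _ ≤ t⁻¹ ^ p.toReal * ‖T^[n] w‖ₑ ^ p.toReal := measure_le_enorm_Lp hp0 hpT _ ht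
        _ ≤ _ := by
            gcongr
            rw [← ofReal_norm]
            exact ofReal_le_ofReal (hB n)
  refine (Lp.eq_zero_iff_ae_eq_zero).2 ?_
  filter_upwards [ae_all_iff.2 h0] with x hx
  obtain ⟨k, hk⟩ := h.cover x
  exact hx k hk

theorem UnboundedWandering.sum_measure_le (h : UnboundedWandering μ e W) (hpT : p ≠ ⊤)
    (hT : ∀ φ : Lp ℂ p μ, (T φ : X → ℂ) =ᵐ[μ] fun x => φ (e x)) {M : ℝ}
    (hM : ∀ v : Lp ℂ p μ, ∃ z, z = T z + v ∧ ‖z‖ ≤ M * ‖v‖) {B : Set X} (hB : MeasurableSet B)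
    {k : ℤ} (hBW : B ⊆ ⇑(e ^ k) ⁻¹' W) (N : ℕ) :
    ∑ j ∈ Finset.range N, μ (⇑(e ^ (-(j + 1 : ℤ))) ⁻¹' B) ≤ ENNReal.ofReal M ^ p.toReal * μ B := by
  have hp0 : p ≠ 0 := (zero_lt_one.trans_le (Fact.out : 1 ≤ p)).ne'
  have hpr : 0 < p.toReal := toReal_pos hp0 hpT
  have hBT : μ B ≠ ⊤ := by
    obtain ⟨-, C, hC, hCB⟩ := h.nonsingular k
    exact ne_top_of_le_ne_top (mul_ne_top hC h.measure_ne_top)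
      ((measure_mono hBW).trans (hCB W h.measurableSet))
  obtain ⟨z, hz, hzM⟩ := hM (indicatorConstLp p hB hBT 1)
  have hrec : ∀ᵐ x ∂μ, ∀ j : ℤ,
      z ((e ^ j) x) = z ((e ^ (j + 1)) x) + B.indicator (fun _ => 1) ((e ^ j) x) := by
    have h1 : ∀ᵐ x ∂μ, z x = z (e x) + B.indicator (fun _ => 1) x := by
      have h2 : (z : X → ℂ) =ᵐ[μ] (T z + indicatorConstLp p hB hBT 1 : Lp ℂ p μ) := by rw [← hz]
      filter_upwards [h2, Lp.coeFn_add (T z) (indicatorConstLp p hB hBT 1), hT z,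
        indicatorConstLp_coeFn (p := p) (hs := hB) (hμs := hBT) (c := (1 : ℂ))] with x h3 h4 h5 h6
      rw [h3, h4, Pi.add_apply, h5, h6]
    simpa only [perm_zpow_add_one_apply] using h.nonsingular.ae_zpow h1
  have hzero : ∀ᵐ x ∂μ, (e ^ k) x ∈ W → z x = 0 := by
    refine h.ae_eq_zero_on (Lp.stronglyMeasurable z).measurable k fun t ht =>
      ⟨t⁻¹ ^ p.toReal * ‖z‖ₑ ^ p.toReal, ?_, fun n => ?_⟩
    · exact mul_ne_top (rpow_ne_top_of_nonneg toReal_nonneg (ENNReal.inv_ne_top.2 ht))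
        (rpow_ne_top_of_nonneg toReal_nonneg enorm_ne_top)
    · refine (measure_mono_ae ?_).trans (measure_le_enorm_Lp hp0 hpT z ht)
      filter_upwards [hrec] with x hx hxt
      have hconst : ∀ i : ℕ, i ≤ n → z ((e ^ (i : ℤ)) x) = z x := by
        intro i
        induction i with
        | zero => simp
        | succ i ih =>
          intro hi
          have hnot : (e ^ (i : ℤ)) x ∉ B := fun hmem => by
            have h1 : (e ^ (k + i)) x ∈ W := by rw [perm_zpow_add_apply]; exact hBW hmem
            have := h.disjoint x _ _ h1 hxt.2
            omega
          have := hx i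
          rw [indicator_of_notMem hnot, add_zero] at this
          rw [Nat.cast_succ, ← this, ih (by omega)]
      change t ≤ _
      rw [← hconst n le_rfl]
      exact hxt.1
  have hneg : ∀ᵐ x ∂μ, ∀ j : ℕ, (e ^ (-(j + 1 : ℤ))) x ∈ B → z x = -1 := by
    filter_upwards [hrec, h.nonsingular.ae_zpow hzero] with x hx hx0 j hj
    set y := -(j + 1 : ℤ) with hy
    have hyz : z ((e ^ y) x) = 0 := hx0 y (hBW hj)
    have hind : ∀ i : ℕ, z ((e ^ (y + i + 1)) x) = -1 := by
      intro i
      induction i with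
      | zero =>
        have := hx y
        rw [hyz, indicator_of_mem hj] at this
        rw [Nat.cast_zero, add_zero]
        exact eq_neg_of_add_eq_zero_left this.symm
      | succ i ih =>
        have hnot : (e ^ (y + i + 1)) x ∉ B := fun hmem => by
          have h1 : (e ^ (k + (y + i + 1))) x ∈ W := by rw [perm_zpow_add_apply]; exact hBW hmem
          have h2 : (e ^ (k + y)) x ∈ W := by rw [perm_zpow_add_apply]; exact hBW hj
          have := h.disjoint x _ _ h1 h2
          omega
        have := hx (y + i + 1)
        rw [indicator_of_notMem hnot, add_zero] at this
        rw [Nat.cast_succ, ← add_assoc y, ← this, ih]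
    have := hind j
    rwa [hy, show -(j + 1 : ℤ) + j + 1 = 0 by ring, zpow_zero] at this
  have hdisj : (Finset.range N : Set ℕ).PairwiseDisjoint
      fun j => ⇑(e ^ (-(j + 1 : ℤ))) ⁻¹' B := by
    intro i _ j _ hij
    refine Set.disjoint_left.2 fun x hi hj => hij ?_
    have h1 : (e ^ (k + -(i + 1 : ℤ))) x ∈ W := by rw [perm_zpow_add_apply]; exact hBW hi
    have h2 : (e ^ (k + -(j + 1 : ℤ))) x ∈ W := by rw [perm_zpow_add_apply]; exact hBW hj
    have := h.disjoint x _ _ h1 h2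
    omega
  rw [← measure_biUnion_finset hdisj fun j _ => (h.nonsingular _).1 hB]
  calc _ ≤ μ {x | 1 ≤ ‖z x‖ₑ} := by
        refine measure_mono_ae ?_
        filter_upwards [hneg] with x hx hxm
        obtain ⟨j, -, hj⟩ := mem_iUnion₂.1 hxm
        change 1 ≤ ‖z x‖ₑ
        rw [hx j hj]
        simp
    _ ≤ ‖z‖ₑ ^ p.toReal := by simpa using measure_le_enorm_Lp hp0 hpT z one_ne_zero
    _ ≤ (ENNReal.ofReal M * ‖indicatorConstLp p hB hBT (1 : ℂ)‖ₑ) ^ p.toReal := by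
        gcongr
        rw [← ofReal_norm, ← ofReal_norm, ← ofReal_mul' (norm_nonneg _)]
        exact ofReal_le_ofReal hzM
    _ = _ := by
        rw [mul_rpow_of_nonneg _ _ hpr.le, Lp.enorm_def, eLpNorm_congr_ae indicatorConstLp_coeFn,
          eLpNorm_indicator_const hB hp0 hpT, enorm_one, one_mul, ← rpow_mul,
          one_div_mul_cancel hpr.ne', rpow_one]

theorem UnboundedWandering.exists_preimage_le (h : UnboundedWandering μ e W) {C : ℝ≥0∞}
    (hC : C ≠ ⊤)
    (hsum : ∀ (k : ℤ) (B : Set X), MeasurableSet B → B ⊆ ⇑(e ^ k) ⁻¹' W → ∀ N : ℕ,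
      ∑ j ∈ Finset.range N, μ (⇑(e ^ (-(j + 1 : ℤ))) ⁻¹' B) ≤ C * μ B)
    {κ : ℝ≥0∞} (hκ : κ ≠ 0) (hκT : κ ≠ ⊤) :
    ∃ N : ℕ, ∀ B : Set X, MeasurableSet B → μ (⇑(e ^ (-(N : ℤ))) ⁻¹' B) ≤ κ * μ B := by
  have hsub : ∀ (k : ℤ) (B : Set X) (m : ℤ), B ⊆ ⇑(e ^ k) ⁻¹' W →
      ⇑(e ^ m) ⁻¹' B ⊆ ⇑(e ^ (k + m)) ⁻¹' W := fun k B m hB => by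
    rw [← preimage_zpow_preimage]; exact preimage_mono hB
  have hone : ∀ (k : ℤ) (B : Set X), MeasurableSet B → B ⊆ ⇑(e ^ k) ⁻¹' W → ∀ m : ℕ,
      μ (⇑(e ^ (-(m : ℤ))) ⁻¹' B) ≤ (C + 1) * μ B := by
    intro k B hB hBW m
    cases m with
    | zero => simpa using le_mul_of_one_le_left (zero_le (a := μ B)) (le_add_self (a := 1) (b := C))
    | succ m =>
      rw [Nat.cast_succ]
      calc _ ≤ ∑ j ∈ Finset.range (m + 1), μ (⇑(e ^ (-(j + 1 : ℤ))) ⁻¹' B) :=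
            Finset.single_le_sum (f := fun j : ℕ => μ (⇑(e ^ (-(j + 1 : ℤ))) ⁻¹' B))
              (fun _ _ => zero_le) (Finset.self_mem_range_succ m)
        _ ≤ C * μ B := hsum k B hB hBW _
        _ ≤ _ := by gcongr; exact le_self_add
  have hmul : ∀ (k : ℤ) (B : Set X), MeasurableSet B → B ⊆ ⇑(e ^ k) ⁻¹' W → ∀ N : ℕ,
      N * μ (⇑(e ^ (-(N : ℤ))) ⁻¹' B) ≤ (C + 1) * C * μ B := by
    intro k B hB hBW N
    calc N * μ (⇑(e ^ (-(N : ℤ))) ⁻¹' B)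
        = ∑ j ∈ Finset.range N, μ (⇑(e ^ (-(N : ℤ))) ⁻¹' B) := by simp
      _ ≤ ∑ j ∈ Finset.range N, (C + 1) * μ (⇑(e ^ (-(j + 1 : ℤ))) ⁻¹' B) := by
          refine Finset.sum_le_sum fun j hj => ?_
          have hj := Finset.mem_range.1 hj
          have := hone _ _ ((h.nonsingular (-(j + 1 : ℤ))).1 hB) (hsub k B _ hBW) (N - (j + 1))
          rwa [preimage_zpow_preimage, Nat.cast_sub hj, Nat.cast_succ,
            show -(j + 1 : ℤ) + -(N - (j + 1)) = -N by ring] at this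
      _ ≤ _ := by
          rw [← Finset.mul_sum, mul_assoc]
          gcongr
          exact hsum k B hB hBW N
  obtain ⟨N, hN⟩ := ENNReal.exists_nat_gt (r := (C + 1) * C / κ)
    (ENNReal.div_lt_top (mul_ne_top (add_ne_top.2 ⟨hC, one_ne_top⟩) hC) hκ).ne
  have hN0 : (N : ℝ≥0∞) ≠ 0 := (zero_le.trans_lt hN).ne'
  have hpiece : ∀ (k : ℤ) (B : Set X), MeasurableSet B → B ⊆ ⇑(e ^ k) ⁻¹' W →
      μ (⇑(e ^ (-(N : ℤ))) ⁻¹' B) ≤ κ * μ B := by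
    intro k B hB hBW
    refine (ENNReal.mul_le_mul_iff_right hN0 (natCast_ne_top N)).1 ?_
    calc _ ≤ (C + 1) * C * μ B := hmul k B hB hBW N
      _ ≤ (N * κ) * μ B := by
          exact mul_le_mul' ((ENNReal.div_le_iff hκ hκT).1 hN.le) le_rfl
      _ = _ := mul_assoc _ _ _
  refine ⟨N, fun B hB => ?_⟩
  set P : ℤ → Set X := fun k => B ∩ ⇑(e ^ k) ⁻¹' W with hP
  have hPm : ∀ k, MeasurableSet (P k) := fun k => hB.inter (h.measurableSet_preimage k)
  have hPd : Pairwise (Function.onFun Disjoint P) := fun i j hij =>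
    Set.disjoint_left.2 fun x hi hj => hij (h.disjoint x i j hi.2 hj.2)
  have hPU : B = ⋃ k, P k := by
    rw [hP, ← inter_iUnion, eq_comm, inter_eq_left]
    exact fun x _ => mem_iUnion.2 (h.cover x)
  calc μ (⇑(e ^ (-(N : ℤ))) ⁻¹' B) = μ (⋃ k, ⇑(e ^ (-(N : ℤ))) ⁻¹' P k) := by
        rw [← preimage_iUnion, ← hPU]
    _ ≤ ∑' k, μ (⇑(e ^ (-(N : ℤ))) ⁻¹' P k) := measure_iUnion_le _
    _ ≤ ∑' k, κ * μ (P k) := ENNReal.tsum_le_tsum fun k => hpiece k _ (hPm k) inter_subset_right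
    _ = κ * μ B := by rw [ENNReal.tsum_mul_left, ← measure_iUnion hPd hPm, ← hPU]

theorem norm_symm_pow_le_half (hn : BoundedlyNonsingular μ e) (hpT : p ≠ ⊤)
    (hT : ∀ φ : Lp ℂ p μ, (T φ : X → ℂ) =ᵐ[μ] fun x => φ (e x)) {N : ℕ}
    (hN : ∀ B : Set X, MeasurableSet B →
      μ (⇑(e ^ (-(N : ℤ))) ⁻¹' B) ≤ (1 / 2 : ℝ≥0∞) ^ p.toReal * μ B) :
    ‖(T.symm : Lp ℂ p μ →L[ℂ] Lp ℂ p μ) ^ N‖ ≤ 1 / 2 := by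
  have hp0 : p ≠ 0 := (zero_lt_one.trans_le (Fact.out : 1 ≤ p)).ne'
  have hpr : 0 < p.toReal := toReal_pos hp0 hpT
  have hmap : μ.map ⇑(e ^ (-(N : ℤ))) ≤ (1 / 2 : ℝ≥0∞) ^ p.toReal • μ :=
    Measure.le_iff.2 fun B hB => by
      rw [Measure.map_apply (hn _).1 hB]; exact hN B hB
  refine ContinuousLinearMap.opNorm_le_bound _ (by norm_num) fun ψ => ?_
  obtain ⟨χ, rfl⟩ : ∃ χ, T^[N] χ = ψ := T.surjective.iterate N ψ
  rw [symm_pow_iterate]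
  set ψ := T^[N] χ with hψ
  have hχ : (χ : X → ℂ) =ᵐ[μ] ψ ∘ ⇑(e ^ (-(N : ℤ))) := by
    filter_upwards [(hn.quasiMeasurePreserving (-(N : ℤ))).ae (iterate_ae_eq hn hT χ N)] with x hx
    rw [Function.comp_apply, hx, ← perm_zpow_add_apply, add_neg_cancel, zpow_zero, Equiv.Perm.one_apply]
  have hle : ‖χ‖ₑ ≤ 1 / 2 * ‖ψ‖ₑ := by
    rw [Lp.enorm_def, Lp.enorm_def, eLpNorm_congr_ae hχ,
      ← eLpNorm_map_measure ((Lp.stronglyMeasurable ψ).aestronglyMeasurable) (hn _).1.aemeasurable]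
    refine (eLpNorm_mono_measure _ hmap).trans_eq ?_
    rw [eLpNorm_smul_measure_of_ne_top hpT, smul_eq_mul, toReal_div, toReal_one, ← rpow_mul,
      mul_one_div_cancel hpr.ne', rpow_one]
  have := toReal_mono (mul_ne_top (by simp) enorm_ne_top) hle
  simpa [toReal_mul] using this

theorem UnboundedWandering.summable_norm_symm_pow (h : UnboundedWandering μ e W) (hpT : p ≠ ⊤)
    (hT : ∀ φ : Lp ℂ p μ, (T φ : X → ℂ) =ᵐ[μ] fun x => φ (e x))
    (hM : ∃ M : ℝ, ∀ v : Lp ℂ p μ, ∃ z, z = T z + v ∧ ‖z‖ ≤ M * ‖v‖) :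
    Summable fun n : ℕ => ‖(T.symm : Lp ℂ p μ →L[ℂ] Lp ℂ p μ) ^ n‖ := by
  obtain ⟨M, hM⟩ := hM
  obtain ⟨N, hN⟩ := h.exists_preimage_le
    (rpow_ne_top_of_nonneg toReal_nonneg (ofReal_ne_top (r := M)))
    (fun k B hB hBW => h.sum_measure_le hpT hT hM hB hBW)
    (κ := (1 / 2 : ℝ≥0∞) ^ p.toReal) (by simp [ENNReal.rpow_eq_zero_iff])
    (rpow_ne_top_of_nonneg toReal_nonneg (by simp))
  exact summable_norm_pow_of_norm_pow_le_half _ N (norm_symm_pow_le_half h.nonsingular hpT hT hN)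

end Composition

/-- Theorem C: if moreover `sup_{n∈ℕ} μ(f⁻ⁿ(W)) = ∞`, then `T_f` is strongly
structurally stable iff it has the shadowing property. -/
theorem stmt_15
    {X : Type*} [MeasurableSpace X] (μ : MeasureTheory.Measure X) [MeasureTheory.SigmaFinite μ]
    (p : ℝ≥0∞) (hp1 : 1 ≤ p) (hpT : p ≠ ⊤)
    (e : Equiv.Perm X) (he : Measurable e) (he' : Measurable e.symm)
    (c c' : ℝ≥0∞) (hc : 0 < c) (hcT : c ≠ ⊤) (hc' : 0 < c') (hc'T : c' ≠ ⊤)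
    (hb : ∀ B : Set X, MeasurableSet B → μ (⇑e ⁻¹' B) ≤ c * μ B)
    (hb' : ∀ B : Set X, MeasurableSet B → μ (⇑e '' B) ≤ c' * μ B)
    (W : Set X) (hWm : MeasurableSet W) (hW0 : 0 < μ W) (hWfin : μ W ≠ ⊤)
    (hcover : (⋃ k : ℤ, ⇑(e ^ k) '' W) = Set.univ)
    (hdisj : Pairwise (fun k l : ℤ => Disjoint (⇑(e ^ k) '' W) (⇑(e ^ l) '' W)))
    (K : ℝ≥0∞) (hK0 : 0 < K) (hKT : K ≠ ⊤)
    (hbd : ∀ (k : ℤ) (B : Set X), MeasurableSet B → B ⊆ W →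
        K⁻¹ * (μ (⇑(e ^ k) '' W) * μ B) ≤ μ (⇑(e ^ k) '' B) * μ W ∧
        μ (⇑(e ^ k) '' B) * μ W ≤ K * (μ (⇑(e ^ k) '' W) * μ B))
    [Fact (1 ≤ p)]
    (T : MeasureTheory.Lp ℂ p μ ≃L[ℂ] MeasureTheory.Lp ℂ p μ)
    (hT : ∀ φ : MeasureTheory.Lp ℂ p μ, (T φ : X → ℂ) =ᵐ[μ] fun x => φ (e x))
    (hsup : (⨆ n : ℕ, μ (⇑(e ^ (n : ℤ)) ⁻¹' W)) = ⊤) :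
    StronglyStructurallyStable T ↔ HasShadowing T := by

  have h : UnboundedWandering μ e W :=
    { nonsingular := boundedlyNonsingular he he' hcT hc'T hb hb'
      measurableSet := hWm
      measure_ne_top := hWfin
      cover := fun x => by
        obtain ⟨k, hk⟩ := mem_iUnion.1 (hcover.ge (mem_univ x))
        exact ⟨-k, by rwa [image_zpow_eq_preimage] at hk⟩
      disjoint := fun x k l hk hl => by
        by_contra hne
        refine Set.disjoint_left.1 (hdisj (neg_injective.ne hne)) (?_ : x ∈ _) ?_ <;>
        · rw [image_zpow_eq_preimage, neg_neg]
          assumption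
      distortion := ⟨K, hKT, fun k B hB hBW => by
        simpa only [image_zpow_eq_preimage, neg_neg] using (hbd (-k) B hB hBW).1⟩
      unbounded := hsup }
  constructor
  · exact fun hS => hasShadowing_of_summable T
      (h.summable_norm_symm_pow hpT hT hS.exists_bounded_solution)
  · exact fun hS => stronglyStructurallyStable_of_summable_s15 T
      (h.summable_norm_symm_pow hpT hT
        (hS.exists_bounded_solution (h.eq_zero_of_bounded_orbit hpT hT)))
end
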